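/- Suppose H ∈ C³(ℝ^N), f is of class C³ on T^N × (0,∞), and m₀, u_T ∈ C^{2,β}(T^N) for some β ∈ (0,1), with m₀ > 0 and ∫_{T^N} m₀ dx = 1; no growth conditions at infinity on f or H are assumed. Then there exists T* > 0 such that for every time horizon T ∈ (0, T*] the MFG system on Q_T = T^N × (0,T) admits a classical solution (u,m). -/

import Mathlib

open MeasureTheory Set Filter Topology

noncomputable section

/-- Points of `ℝ^N`.  `ℤ^N`-periodic functions on `RN N` model functions on the
flat torus `T^N`. -/
abbrev RN (N : ℕ) := Fin N → ℝ

/-- The Euclidean norm on `ℝ^N`. -/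
def euclNorm {N : ℕ} (p : RN N) : ℝ := Real.sqrt (∑ i, p i ^ 2)

/-- The Euclidean inner product on `ℝ^N`. -/
def dotp {N : ℕ} (p q : RN N) : ℝ := ∑ i, p i * q i

/-- `ℤ^N`-periodicity: such functions are exactly the functions on the flat torus `T^N`. -/
def ZPeriodic {N : ℕ} {β : Type*} (u : RN N → β) : Prop :=
  ∀ (x : RN N) (z : Fin N → ℤ), u (fun i => x i + (z i : ℝ)) = u x

/-- Partial derivative in the `i`-th coordinate direction. -/
def pd {N : ℕ} (i : Fin N) (u : RN N → ℝ) (x : RN N) : ℝ := fderiv ℝ u x (Pi.single i 1)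

/-- Spatial gradient. -/
def grad {N : ℕ} (u : RN N → ℝ) (x : RN N) : RN N := fun i => pd i u x

/-- Divergence of a vector field. -/
def dive {N : ℕ} (w : RN N → RN N) (x : RN N) : ℝ := ∑ i, pd i (fun y => w y i) x

/-- Laplacian. -/
def lap {N : ℕ} (u : RN N → ℝ) (x : RN N) : ℝ := ∑ i, pd i (pd i u) x

/-- The unit cube, a fundamental domain for the torus `T^N` (of total measure `1`,
so that the measure on the torus is the normalized one). -/
def cube (N : ℕ) : Set (RN N) := Set.Icc 0 1

/-- The space-time cylinder `Q = T^N × (0,T)`. -/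
def QQ (N : ℕ) (T : ℝ) : Set (RN N × ℝ) := cube N ×ˢ Ioo 0 T

/-- Integral over `Q = T^N × (0,T)`. -/
def intQ (N : ℕ) (T : ℝ) (f : RN N → ℝ → ℝ) : ℝ := ∫ q in QQ N T, f q.1 q.2

/-- Smooth space-periodic test functions on `T^N × [0,T]`. -/
def IsTest (N : ℕ) (φ : RN N → ℝ → ℝ) : Prop :=
  ContDiff ℝ (⊤ : ℕ∞) (fun q : RN N × ℝ => φ q.1 q.2) ∧ ∀ t, ZPeriodic fun x => φ x t

/-- The Legendre transform `L(q) = sup_p (p·q - H(p))`. -/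
def Leg {N : ℕ} (H : RN N → ℝ) (q : RN N) : ℝ := sSup ((fun p => dotp p q - H p) '' Set.univ)

/-- `m L(-w/m)`, with the convention that it vanishes when `m ≤ 0` (recall that in `K`
one has `w = 0` a.e. on `{m = 0}`). -/
def mLag {N : ℕ} (L : RN N → ℝ) (mv : ℝ) (wv : RN N) : ℝ :=
  if 0 < mv then mv * L ((-mv⁻¹) • wv) else 0

/-- `|w|^{γ'} m^{1-γ'}`, with the convention that it vanishes when `m ≤ 0`. -/
def kinQ {N : ℕ} (γ' : ℝ) (mv : ℝ) (wv : RN N) : ℝ :=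
  if 0 < mv then euclNorm wv ^ γ' * mv ^ (1 - γ') else 0

/-- `F(x,m) = ∫_0^m f(x,σ) dσ`. -/
def Fint {N : ℕ} (f : RN N → ℝ → ℝ) (x : RN N) (mv : ℝ) : ℝ := ∫ σ in (0:ℝ)..mv, f x σ

/-- The convexifying term `G(x,t,m)`, as a function of `m̄(x,t)` (argument `mb`) and `m`. -/
def Gcvx (c_f α mb mv : ℝ) : ℝ :=
  ((c_f + 1) / (α * (α + 1))) * ((mv + 1) ^ (α + 1) - (mb + 1) ^ (α + 1))
    - ((c_f + 1) / α) * (mb + 1) ^ α * (mv - mb)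

/-- `g = ∂_m G`, as a function of `m̄(x,t)` (argument `mb`) and `m`. -/
def gcvx (c_f α mb mv : ℝ) : ℝ := ((c_f + 1) / α) * ((mv + 1) ^ α - (mb + 1) ^ α)

/-- The penalised Lagrangian `L_η(q) = L(q) + (η/(N+3)) |q|^{N+3}`. -/
def Lpen {N : ℕ} (L : RN N → ℝ) (η : ℝ) (q : RN N) : ℝ :=
  L q + (η / ((N : ℝ) + 3)) * euclNorm q ^ ((N : ℝ) + 3)

/-- The penalised Hamiltonian `H_η`, the Legendre transform of `L_η`. -/
def Hpen {N : ℕ} (L : RN N → ℝ) (η : ℝ) : RN N → ℝ := Leg (Lpen L η)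

/-- `g` is the weak spatial gradient of `m` on `Q`. -/
def HasWeakGradQ (N : ℕ) (T : ℝ) (m : RN N → ℝ → ℝ) (g : RN N → ℝ → RN N) : Prop :=
  ∀ Φ : RN N → ℝ → RN N, ContDiff ℝ (⊤ : ℕ∞) (fun q : RN N × ℝ => Φ q.1 q.2) →
    (∀ t, ZPeriodic fun x => Φ x t) →
    intQ N T (fun x t => m x t * dive (fun y => Φ y t) x)
      = -intQ N T (fun x t => dotp (g x t) (Φ x t))

/-- `m` is `θ`-Hölder continuous on `T^N × [0,T]` with constant `C`. -/
def HolderOnQ (N : ℕ) (T C θ : ℝ) (m : RN N → ℝ → ℝ) : Prop :=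
  ∀ x t x' t', t ∈ Icc (0:ℝ) T → t' ∈ Icc (0:ℝ) T →
    |m x t - m x' t'| ≤
      C * Real.sqrt (euclNorm (fun i => x i - x' i) ^ 2 + (t - t') ^ 2) ^ θ

/-- Membership in the constraint set `K`: `(m,w) ∈ L^{α+1}(Q) × L¹(Q;ℝ^N)`, `m ≥ 0`,
`|w|^{γ'} m^{1-γ'} ∈ L¹(Q)`, together with the weak Fokker–Planck constraint
(with initial datum `m₀`); the field `traceId` states that `m(·,T)` is the time-`T`
trace of `m` determined by the constraint. -/
structure MemK (N : ℕ) (T α γ' : ℝ) (m₀ : RN N → ℝ)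
    (m : RN N → ℝ → ℝ) (w : RN N → ℝ → RN N) : Prop where
  per_m : ∀ t, ZPeriodic fun x => m x t
  per_w : ∀ t, ZPeriodic fun x => w x t
  nonneg : ∀ x t, 0 ≤ m x t
  lp_m : IntegrableOn (fun q : RN N × ℝ => m q.1 q.2 ^ (α + 1)) (QQ N T)
  l1_w : IntegrableOn (fun q : RN N × ℝ => w q.1 q.2) (QQ N T)
  vanish : ∀ᵐ q ∂(volume.restrict (QQ N T)), m q.1 q.2 = 0 → w q.1 q.2 = 0
  kin_int : IntegrableOn (fun q : RN N × ℝ => kinQ γ' (m q.1 q.2) (w q.1 q.2)) (QQ N T)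
  traceInt : IntegrableOn (fun x => m x T) (cube N)
  fp : ∀ φ : RN N → ℝ → ℝ, IsTest N φ → (∀ x, φ x T = 0) →
    intQ N T (fun x t => m x t * deriv (φ x) t + dotp (w x t) (grad (fun y => φ y t) x)
        + m x t * lap (fun y => φ y t) x)
      + (∫ x in cube N, m₀ x * φ x 0) = 0
  traceId : ∀ φ : RN N → ℝ → ℝ, IsTest N φ →
    intQ N T (fun x t => m x t * deriv (φ x) t + dotp (w x t) (grad (fun y => φ y t) x)
        + m x t * lap (fun y => φ y t) x)
      + (∫ x in cube N, m₀ x * φ x 0) - (∫ x in cube N, m x T * φ x T) = 0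

/-- The energy functional `E` on `K`, with Lagrangian `L` and coupling antiderivative `F`. -/
def energyF (N : ℕ) (T : ℝ) (L : RN N → ℝ) (F : RN N → ℝ → ℝ) (uT : RN N → ℝ)
    (m : RN N → ℝ → ℝ) (w : RN N → ℝ → RN N) : ℝ :=
  intQ N T (fun x t => mLag L (m x t) (w x t) - F x (m x t)) + ∫ x in cube N, uT x * m x T

/-- `(m,w)` belongs to `K` and minimises the energy over `K`. -/
def MinimisesE (N : ℕ) (T α γ' : ℝ) (m₀ : RN N → ℝ) (L : RN N → ℝ) (F : RN N → ℝ → ℝ)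
    (uT : RN N → ℝ) (m : RN N → ℝ → ℝ) (w : RN N → ℝ → RN N) : Prop :=
  MemK N T α γ' m₀ m w ∧
    ∀ m' w', MemK N T α γ' m₀ m' w' → energyF N T L F uT m w ≤ energyF N T L F uT m' w'

/-- Classical solution of the MFG system `-∂_t u - Δu + H(∇u) = fc(x,t,m)`,
`∂_t m - Δm - div(∇H(∇u) m) = 0`, `m(·,0) = m₀`, `u(·,T) = u_T`:
`u, m` are continuous on `T^N × [0,T]` together with `∂_t u, ∂_t m` and all first and
second space derivatives, and the equations hold pointwise. -/
structure ClassicalSol (N : ℕ) (T : ℝ) (H : RN N → ℝ) (fc : RN N → ℝ → ℝ → ℝ)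
    (m₀ uT : RN N → ℝ) (u m : RN N → ℝ → ℝ) : Prop where
  per_u : ∀ t, ZPeriodic fun x => u x t
  per_m : ∀ t, ZPeriodic fun x => m x t
  cont_u : ContinuousOn (fun q : RN N × ℝ => u q.1 q.2) ((Set.univ : Set (RN N)) ×ˢ Icc 0 T)
  cont_m : ContinuousOn (fun q : RN N × ℝ => m q.1 q.2) ((Set.univ : Set (RN N)) ×ˢ Icc 0 T)
  cont_ut : ContinuousOn (fun q : RN N × ℝ => deriv (u q.1) q.2)
    ((Set.univ : Set (RN N)) ×ˢ Icc 0 T)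
  cont_mt : ContinuousOn (fun q : RN N × ℝ => deriv (m q.1) q.2)
    ((Set.univ : Set (RN N)) ×ˢ Icc 0 T)
  cont_du : ∀ i, ContinuousOn (fun q : RN N × ℝ => pd i (fun y => u y q.2) q.1)
    ((Set.univ : Set (RN N)) ×ˢ Icc 0 T)
  cont_dm : ∀ i, ContinuousOn (fun q : RN N × ℝ => pd i (fun y => m y q.2) q.1)
    ((Set.univ : Set (RN N)) ×ˢ Icc 0 T)
  cont_ddu : ∀ i j, ContinuousOn (fun q : RN N × ℝ => pd i (pd j fun y => u y q.2) q.1)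
    ((Set.univ : Set (RN N)) ×ˢ Icc 0 T)
  cont_ddm : ∀ i j, ContinuousOn (fun q : RN N × ℝ => pd i (pd j fun y => m y q.2) q.1)
    ((Set.univ : Set (RN N)) ×ˢ Icc 0 T)
  tdiff_u : ∀ x, ∀ t ∈ Ioo 0 T, DifferentiableAt ℝ (u x) t
  tdiff_m : ∀ x, ∀ t ∈ Ioo 0 T, DifferentiableAt ℝ (m x) t
  xdiff_u : ∀ t ∈ Icc 0 T,
    Differentiable ℝ (fun y => u y t) ∧ ∀ i, Differentiable ℝ (pd i fun y => u y t)
  xdiff_m : ∀ t ∈ Icc 0 T,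
    Differentiable ℝ (fun y => m y t) ∧ ∀ i, Differentiable ℝ (pd i fun y => m y t)
  hjb : ∀ x, ∀ t ∈ Ioo 0 T,
    -deriv (u x) t - lap (fun y => u y t) x + H (grad (fun y => u y t) x) = fc x t (m x t)
  fkp : ∀ x, ∀ t ∈ Ioo 0 T,
    deriv (m x) t - lap (fun y => m y t) x
      - dive (fun y => m y t • grad H (grad (fun z => u z t) y)) x = 0
  init : ∀ x, m x 0 = m₀ x
  final : ∀ x, u x T = uT x

/-- Weak solution `(u,m)` (with weak spatial gradient `Du` of `u`) of the MFG system
`-∂_t u - Δu + H(∇u) = fc(x,t,m)`, `∂_t m - Δm - div(∇H(∇u) m) = 0`, `m(·,0) = m₀`,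
`u(·,T) = u_T`, in the sense of Definition 3.1 of the paper. -/
structure WeakSol (N : ℕ) (T γ α : ℝ) (H : RN N → ℝ) (fc : RN N → ℝ → ℝ → ℝ)
    (m₀ uT : RN N → ℝ) (u m : RN N → ℝ → ℝ) (Du : RN N → ℝ → RN N) : Prop where
  per_u : ∀ t, ZPeriodic fun x => u x t
  per_m : ∀ t, ZPeriodic fun x => m x t
  per_Du : ∀ t, ZPeriodic fun x => Du x t
  nonneg_m : ∀ x t, 0 ≤ m x t
  lp_m : IntegrableOn (fun q : RN N × ℝ => m q.1 q.2 ^ (α + 1)) (QQ N T)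
  lq_u_sup : α < γ / N → ∃ C, ∀ᵐ q ∂(volume.restrict (QQ N T)), |u q.1 q.2| ≤ C
  lq_u_int : γ / N < α →
    IntegrableOn (fun q : RN N × ℝ =>
      |u q.1 q.2| ^ (γ * (α + 1) * (1 + (N : ℝ)) / (α * N - γ))) (QQ N T)
  weak_grad : HasWeakGradQ N T u Du
  lγ_Du : IntegrableOn (fun q : RN N × ℝ => euclNorm (Du q.1 q.2) ^ γ) (QQ N T)
  int_mL : IntegrableOn (fun q : RN N × ℝ =>
      m q.1 q.2 * Leg H (grad H (Du q.1 q.2))) (QQ N T)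
  int_mDH : IntegrableOn (fun q : RN N × ℝ => m q.1 q.2 • grad H (Du q.1 q.2)) (QQ N T)
  hjb : ∀ φ : RN N → ℝ → ℝ, IsTest N φ → (∀ x t, 0 ≤ φ x t) →
    (∃ ε > (0:ℝ), ∀ x, ∀ t ≤ ε, φ x t = 0) →
    intQ N T (fun x t => u x t * deriv (φ x) t - u x t * lap (fun y => φ y t) x
        + (H (Du x t) - fc x t (m x t)) * φ x t)
      ≤ ∫ x in cube N, uT x * φ x T
  fkp : ∀ φ : RN N → ℝ → ℝ, IsTest N φ → (∀ x, φ x T = 0) →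
    intQ N T (fun x t => m x t * deriv (φ x) t
        - dotp (m x t • grad H (Du x t)) (grad (fun y => φ y t) x)
        + m x t * lap (fun y => φ y t) x)
      + (∫ x in cube N, m₀ x * φ x 0) = 0
  energy_id : intQ N T (fun x t =>
        m x t * (-(fc x t (m x t)) + Leg H (grad H (Du x t))))
      + (∫ x in cube N, (m x T * uT x - m₀ x * u x 0)) = 0

/-- Nonnegative weak solution of the Fokker–Planck equation
`∂_t m - Δm + div(A m) = 0` in `Q`, `m(·,0) = m₀`, with finite energy
`E = ∫_Q |A|^{γ'} m < ∞`. -/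
structure FPSol (N : ℕ) (T γ' : ℝ) (m₀ : RN N → ℝ) (m : RN N → ℝ → ℝ)
    (A : RN N → ℝ → RN N) : Prop where
  per_m : ∀ t, ZPeriodic fun x => m x t
  per_A : ∀ t, ZPeriodic fun x => A x t
  nonneg : ∀ x t, 0 ≤ m x t
  int_m : IntegrableOn (fun q : RN N × ℝ => m q.1 q.2) (QQ N T)
  int_E : IntegrableOn (fun q : RN N × ℝ => euclNorm (A q.1 q.2) ^ γ' * m q.1 q.2) (QQ N T)
  weak : ∀ φ : RN N → ℝ → ℝ, IsTest N φ → (∀ x, φ x T = 0) →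
    intQ N T (fun x t => m x t * (deriv (φ x) t + lap (fun y => φ y t) x
        + dotp (A x t) (grad (fun y => φ y t) x)))
      + (∫ x in cube N, m₀ x * φ x 0) = 0

/-- Conditions on the initial datum of the Fokker–Planck equation: a periodic (i.e.
defined on the torus) Lipschitz probability density, with `‖∇m₀‖_∞ ≤ K₀`. -/
def FPData (N : ℕ) (K₀ : ℝ) (m₀ : RN N → ℝ) : Prop :=
  ZPeriodic m₀ ∧ (∀ x, 0 ≤ m₀ x) ∧ (∫ x in cube N, m₀ x) = 1 ∧
    Differentiable ℝ m₀ ∧ ∀ x, euclNorm (grad m₀ x) ≤ K₀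

/-- The standard Gaussian density on `ℝ^N`. -/
def gaussD {N : ℕ} (z : RN N) : ℝ := (√(2 * Real.pi))⁻¹ ^ N * Real.exp (-(∑ i, z i ^ 2) / 2)

/-- The weight `-∂_i φ = z_i φ` attached to the Gaussian density `φ`. -/
def gaussD1 {N : ℕ} (i : Fin N) (z : RN N) : ℝ := z i * gaussD z

/-- The weight `∂_i ∂_j φ = (z_i z_j - δ_ij) φ` attached to the Gaussian density `φ`. -/
def gaussD2 {N : ℕ} (i j : Fin N) (z : RN N) : ℝ :=
  (z i * z j - if i = j then 1 else 0) * gaussD z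

/-- The differential form with given coefficients. -/
def formOf {N : ℕ} (a : Fin N → ℝ) : RN N →L[ℝ] ℝ :=
  ∑ i, a i • ContinuousLinearMap.proj (R := ℝ) (φ := fun _ : Fin N => ℝ) i

@[simp] lemma formOf_apply {N : ℕ} (a : Fin N → ℝ) (v : RN N) : formOf a v = ∑ i, a i * v i := by
  simp [formOf]

lemma formOf_single {N : ℕ} (a : Fin N → ℝ) (i : Fin N) : formOf a (Pi.single i 1) = a i := by
  simp [formOf_apply, Pi.single_apply]

lemma continuous_formOf {N : ℕ} {X : Type*} [TopologicalSpace X] {a : X → Fin N → ℝ}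
    (ha : ∀ i, Continuous fun x => a x i) : Continuous fun x => formOf (a x) := by
  unfold formOf
  exact continuous_finsetSum _ fun i _ => (ha i).smul continuous_const

lemma clm_ext_single {N : ℕ} {ℓ ℓ' : RN N →L[ℝ] ℝ}
    (h : ∀ i, ℓ (Pi.single i 1) = ℓ' (Pi.single i 1)) : ℓ = ℓ' := by
  refine ContinuousLinearMap.coe_injective (LinearMap.pi_ext' fun i => LinearMap.ext_ring ?_)
  simpa using h i

lemma clm_eq_formOf {N : ℕ} (ℓ : RN N →L[ℝ] ℝ) : ℓ = formOf fun i => ℓ (Pi.single i 1) :=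
  clm_ext_single fun i => by rw [formOf_single]

lemma norm_formOf_le {N : ℕ} (a : Fin N → ℝ) : ‖formOf a‖ ≤ ∑ i, |a i| := by
  refine ContinuousLinearMap.opNorm_le_bound _ (Finset.sum_nonneg fun i _ => abs_nonneg _) fun v => ?_
  rw [formOf_apply, Finset.sum_mul]
  refine (norm_sum_le _ _).trans (Finset.sum_le_sum fun i _ => ?_)
  rw [norm_mul]
  exact mul_le_mul_of_nonneg_left (norm_le_pi_norm v i) (abs_nonneg _)

lemma pd_eq_of_hasFDerivAt {N : ℕ} {u : RN N → ℝ} {a : Fin N → ℝ} {x : RN N}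
    (h : HasFDerivAt u (formOf a) x) (i : Fin N) : pd i u x = a i := by
  rw [pd, h.fderiv, formOf_single]

lemma hasFDerivAt_formOf_pd {N : ℕ} {u : RN N → ℝ} {x : RN N} (h : DifferentiableAt ℝ u x) :
    HasFDerivAt u (formOf fun i => pd i u x) x := by
  have := h.hasFDerivAt
  rwa [clm_eq_formOf (fderiv ℝ u x)] at this

/-- A function with continuous Gateaux differential is Fréchet differentiable. -/
lemma hasFDerivAt_of_gateaux {E : Type*} [NormedAddCommGroup E] [NormedSpace ℝ E]
    {Φ : E → ℝ} {Ψ : E → E →L[ℝ] ℝ} (hΨ : Continuous Ψ)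
    (h : ∀ x v, HasDerivAt (fun s : ℝ => Φ (x + s • v)) (Ψ x v) 0) (x : E) :
    HasFDerivAt Φ (Ψ x) x := by
  have key : ∀ x v, ∀ s : ℝ, HasDerivAt (fun s : ℝ => Φ (x + s • v)) (Ψ (x + s • v) v) s := by
    intro x v s
    have h1 := h (x + s • v) v
    have h2 : HasDerivAt (fun r : ℝ => r - s) 1 s := (hasDerivAt_id s).sub_const s
    have h3 := HasDerivAt.comp s (h₂ := fun s' : ℝ => Φ (x + s • v + s' • v)) (h := fun r => r - s)
      (by simpa using h1) h2
    refine (h3.congr_deriv (by simp)).congr_of_eventuallyEq (Eventually.of_forall fun r => ?_)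
    simp only [Function.comp]
    congr 1
    module
  rw [hasFDerivAt_iff_isLittleO_nhds_zero, Asymptotics.isLittleO_iff]
  intro c hc
  have h0 := Metric.continuousAt_iff.1 (hΨ.continuousAt (x := x)) c hc
  obtain ⟨δ, hδ, hδ'⟩ := h0
  filter_upwards [Metric.ball_mem_nhds (0 : E) hδ] with v hv
  have hv' : ‖v‖ < δ := by simpa using hv
  have := norm_image_sub_le_of_norm_deriv_le_segment_01' (f := fun s : ℝ => Φ (x + s • v) - s * Ψ x v)
    (f' := fun s => Ψ (x + s • v) v - 1 * Ψ x v) (C := c * ‖v‖)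
    (fun s _ => ((key x v s).sub ((hasDerivAt_id s).mul_const _)).hasDerivWithinAt) ?_
  · simpa [sub_right_comm] using this
  · intro s hs
    have h1 : dist (x + s • v) x < δ := by
      rw [dist_eq_norm, add_sub_cancel_left, norm_smul, Real.norm_of_nonneg hs.1]
      nlinarith [norm_nonneg v, hs.2]
    have h2 := (hδ' h1).le
    rw [dist_eq_norm] at h2
    rw [one_mul, ← sub_apply]
    exact (ContinuousLinearMap.le_opNorm _ _).trans (by gcongr)

lemma gaussD_nonneg {N : ℕ} (z : RN N) : 0 ≤ gaussD z := by unfold gaussD; positivity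

lemma continuous_gaussD {N : ℕ} : Continuous (gaussD (N := N)) := by unfold gaussD; fun_prop

lemma continuous_gaussD1 {N : ℕ} (i : Fin N) : Continuous (gaussD1 i) := by
  unfold gaussD1; have := continuous_gaussD (N := N); fun_prop

lemma continuous_gaussD2 {N : ℕ} (i j : Fin N) : Continuous (gaussD2 i j) := by
  unfold gaussD2; have := continuous_gaussD (N := N); fun_prop

lemma hasFDerivAt_gaussD {N : ℕ} (z : RN N) :
    HasFDerivAt gaussD (-formOf fun i => gaussD1 i z) z := by
  have h1 : HasFDerivAt (fun z : RN N => -(∑ i, z i ^ 2) / 2) (formOf fun i => -z i) z := by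
    have : ∀ i : Fin N, HasFDerivAt (fun z : RN N => z i ^ 2)
        ((2 * z i) • ContinuousLinearMap.proj (R := ℝ) (φ := fun _ : Fin N => ℝ) i) z := by
      intro i
      have := (ContinuousLinearMap.proj (R := ℝ) (φ := fun _ : Fin N => ℝ) i).hasFDerivAt (x := z)
      simpa using this.pow 2
    have h2 := (HasFDerivAt.fun_sum fun i (_ : i ∈ Finset.univ) => this i).neg.mul_const (2⁻¹ : ℝ)
    refine (h2.congr_fderiv ?_)
    refine clm_ext_single fun v => ?_
    rw [formOf_single]
    simp [Pi.single_apply]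
  have h2 := (h1.exp).const_mul ((√(2 * Real.pi))⁻¹ ^ N)
  refine h2.congr_fderiv ?_
  refine clm_ext_single fun v => ?_
  simp only [smul_apply, neg_apply, formOf_single, gaussD1, gaussD, smul_eq_mul]
  ring

lemma hasFDerivAt_gaussD1 {N : ℕ} (i : Fin N) (z : RN N) :
    HasFDerivAt (gaussD1 i) (-formOf fun j => gaussD2 i j z) z := by
  have h1 := (ContinuousLinearMap.proj (R := ℝ) (φ := fun _ : Fin N => ℝ) i).hasFDerivAt (x := z)
  refine (h1.mul (hasFDerivAt_gaussD z)).congr_fderiv ?_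
  refine clm_ext_single fun v => ?_
  simp only [smul_apply, neg_apply, add_apply, formOf_single, gaussD1, gaussD2, smul_eq_mul,
    ContinuousLinearMap.proj_apply, Pi.single_apply]
  ring

lemma norm_sq_le_sum_sq {N : ℕ} (z : RN N) : ‖z‖ ^ 2 ≤ ∑ i, z i ^ 2 := by
  have h0 : (0:ℝ) ≤ ∑ i, z i ^ 2 := Finset.sum_nonneg fun i _ => sq_nonneg _
  rw [← Real.le_sqrt (norm_nonneg _) h0]
  refine (pi_norm_le_iff_of_nonneg (Real.sqrt_nonneg _)).2 fun i => ?_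
  rw [Real.norm_eq_abs]
  refine Real.abs_le_sqrt ?_
  exact Finset.single_le_sum (f := fun i => z i ^ 2) (fun i _ => sq_nonneg _) (Finset.mem_univ i)

lemma integrable_exp_neg_mul_sum_sq {N : ℕ} {b : ℝ} (hb : 0 < b) :
    Integrable fun z : RN N => Real.exp (-b * ∑ i, z i ^ 2) := by
  have : Integrable (fun z : Fin N → ℝ => ∏ i, Real.exp (-b * z i ^ 2)) :=
    Integrable.fintype_prod (f := fun _ (x : ℝ) => Real.exp (-b * x ^ 2))
      fun _ => integrable_exp_neg_mul_sq hb
  refine this.congr (Eventually.of_forall fun z => ?_)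
  simp only [← Real.exp_sum, Finset.mul_sum]

lemma integrable_pow_mul_exp {N : ℕ} {b : ℝ} (hb : 0 < b) (n : ℕ) :
    Integrable fun z : RN N => ‖z‖ ^ n * Real.exp (-b * ∑ i, z i ^ 2) := by
  have h := (integrable_exp_neg_mul_sum_sq (N := N) (half_pos hb)).const_mul
    (n.factorial * Real.exp (1 / (2 * b)))
  refine h.mono' (by fun_prop) (Eventually.of_forall fun z => ?_)
  rw [Real.norm_of_nonneg (by positivity)]
  have h1 := Real.pow_div_factorial_le_exp ‖z‖ (norm_nonneg z) n
  rw [div_le_iff₀ (by positivity)] at h1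
  have h2 : ‖z‖ ≤ 1 / (2 * b) + b / 2 * ∑ i, z i ^ 2 := by
    have h3 := norm_sq_le_sum_sq z
    have : ‖z‖ ≤ 1 / (2 * b) + b / 2 * ‖z‖ ^ 2 := by
      have h4 : 1 / (2 * b) + b / 2 * ‖z‖ ^ 2 - ‖z‖ = (b * ‖z‖ - 1) ^ 2 / (2 * b) := by
        field_simp
        ring
      have : 0 ≤ (b * ‖z‖ - 1) ^ 2 / (2 * b) := by positivity
      linarith
    have : b / 2 * ‖z‖ ^ 2 ≤ b / 2 * ∑ i, z i ^ 2 := by gcongr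
    linarith
  calc ‖z‖ ^ n * Real.exp (-b * ∑ i, z i ^ 2)
      ≤ (Real.exp (1 / (2 * b) + b / 2 * ∑ i, z i ^ 2) * n.factorial)
          * Real.exp (-b * ∑ i, z i ^ 2) := by
        gcongr
        exact h1.trans (by gcongr)
    _ = n.factorial * Real.exp (1 / (2 * b)) * Real.exp (-(b / 2) * ∑ i, z i ^ 2) := by
        rw [mul_right_comm, ← Real.exp_add, mul_assoc (n.factorial : ℝ), ← Real.exp_add, mul_comm]
        congr 2
        ring

lemma integrable_pow_mul_gaussD {N : ℕ} (n : ℕ) :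
    Integrable fun z : RN N => ‖z‖ ^ n * gaussD z := by
  refine ((integrable_pow_mul_exp (N := N) (b := 1 / 2) (by norm_num) n).const_mul
    ((√(2 * Real.pi))⁻¹ ^ N)).congr (Eventually.of_forall fun z => ?_)
  simp only [gaussD]
  rw [show -(1 / 2 : ℝ) * ∑ i, z i ^ 2 = -(∑ i, z i ^ 2) / 2 by ring]
  ring

lemma integrable_gaussD {N : ℕ} : Integrable (gaussD (N := N)) := by
  simpa using integrable_pow_mul_gaussD (N := N) 0

lemma integral_gaussD {N : ℕ} : ∫ z : RN N, gaussD z = 1 := by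
  have h : ∀ z : RN N, gaussD z
      = ∏ i, ((√(2 * Real.pi))⁻¹ * Real.exp (-(1 / 2) * z i ^ 2)) := by
    intro z
    rw [Finset.prod_mul_distrib, ← Real.exp_sum, gaussD, Finset.prod_const, Finset.card_univ,
      Fintype.card_fin, ← Finset.mul_sum]
    congr 2
    ring
  simp_rw [h]
  rw [integral_fintype_prod_volume_eq_prod (fun (_ : Fin N) (x : ℝ) =>
    (√(2 * Real.pi))⁻¹ * Real.exp (-(1 / 2) * x ^ 2))]
  refine Finset.prod_eq_one fun i _ => ?_
  rw [integral_const_mul, integral_gaussian]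
  rw [show Real.pi / (1 / 2) = 2 * Real.pi by ring]
  exact inv_mul_cancel₀ (by positivity)

lemma abs_gaussD1_le {N : ℕ} (i : Fin N) (z : RN N) : |gaussD1 i z| ≤ ‖z‖ ^ 1 * gaussD z := by
  rw [gaussD1, abs_mul, abs_of_nonneg (gaussD_nonneg z), pow_one]
  exact mul_le_mul_of_nonneg_right (norm_le_pi_norm z i) (gaussD_nonneg z)

lemma abs_gaussD2_le {N : ℕ} (i j : Fin N) (z : RN N) :
    |gaussD2 i j z| ≤ (‖z‖ ^ 2 + 1) * gaussD z := by
  rw [gaussD2, abs_mul, abs_of_nonneg (gaussD_nonneg z)]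
  refine mul_le_mul_of_nonneg_right ?_ (gaussD_nonneg z)
  refine (abs_sub _ _).trans (add_le_add ?_ ?_)
  · rw [abs_mul, sq]
    exact mul_le_mul (norm_le_pi_norm z i) (norm_le_pi_norm z j) (abs_nonneg _) (norm_nonneg _)
  · split_ifs <;> simp

lemma integrable_gaussD1 {N : ℕ} (i : Fin N) : Integrable (gaussD1 i) :=
  (integrable_pow_mul_gaussD 1).mono' (continuous_gaussD1 i).aestronglyMeasurable
    (Eventually.of_forall fun z => abs_gaussD1_le i z)

lemma integrable_gaussD2 {N : ℕ} (i j : Fin N) : Integrable (gaussD2 i j) := by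
  refine ((integrable_pow_mul_gaussD 2).add (integrable_pow_mul_gaussD 0)).mono'
    (continuous_gaussD2 i j).aestronglyMeasurable (Eventually.of_forall fun z => ?_)
  refine (abs_gaussD2_le i j z).trans (le_of_eq ?_)
  simp only [Pi.add_apply]; ring

lemma integrable_rpow_mul_gaussD2 {N : ℕ} (i j : Fin N) {β : ℝ} (hβ : β ∈ Ioo (0 : ℝ) 1) :
    Integrable fun z => ‖z‖ ^ β * |gaussD2 i j z| := by
  refine ((((integrable_pow_mul_gaussD 2).add (integrable_pow_mul_gaussD 0)).add
    (integrable_pow_mul_gaussD 3)).add (integrable_pow_mul_gaussD 1)).mono'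
    ?_ (Eventually.of_forall fun z => ?_)
  · exact ((continuous_norm.rpow_const fun _ => Or.inr hβ.1.le).mul
      (continuous_gaussD2 i j).abs).aestronglyMeasurable
  rw [Real.norm_of_nonneg (by positivity)]
  have h1 : ‖z‖ ^ β ≤ 1 + ‖z‖ := by
    rcases le_total ‖z‖ 1 with h | h
    · have := Real.rpow_le_one (norm_nonneg z) h hβ.1.le
      linarith [norm_nonneg z]
    · have := Real.rpow_le_rpow_of_exponent_le h hβ.2.le
      rw [Real.rpow_one] at this
      linarith
  refine (mul_le_mul h1 (abs_gaussD2_le i j z) (abs_nonneg _) (by positivity)).trans (le_of_eq ?_)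
  simp only [Pi.add_apply]; ring

lemma integrable_mul_bounded {α : Type*} [TopologicalSpace α] [MeasurableSpace α]
    [OpensMeasurableSpace α] [SecondCountableTopologyEither α ℝ] {μ : Measure α} {k g : α → ℝ}
    {M : ℝ} (hk : Integrable k μ) (hg : Continuous g) (hM : ∀ z, |g z| ≤ M) :
    Integrable (fun z => k z * g z) μ :=
  hk.mul_bdd hg.aestronglyMeasurable (Eventually.of_forall hM)

/-- The average `∫ k(z) g(x + ρ z) dz`. -/
def avg {N : ℕ} (k g : RN N → ℝ) (ρ : ℝ) (x : RN N) : ℝ := ∫ z, k z * g (x + ρ • z)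

lemma abs_integral_mul_le {N : ℕ} {k g : RN N → ℝ} {M : ℝ} (hk : Integrable k)
    (hM : ∀ z, |g z| ≤ M) : |∫ z, k z * g z| ≤ (∫ z, |k z|) * M := by
  rw [← integral_mul_const, ← Real.norm_eq_abs]
  refine norm_integral_le_of_norm_le (hk.abs.mul_const M) (Eventually.of_forall fun z => ?_)
  rw [norm_mul]
  exact mul_le_mul_of_nonneg_left (hM z) (abs_nonneg _)

lemma abs_avg_le {N : ℕ} {k g : RN N → ℝ} {M : ℝ} (hk : Integrable k)
    (hM : ∀ z, |g z| ≤ M) (ρ : ℝ) (x : RN N) : |avg k g ρ x| ≤ (∫ z, |k z|) * M :=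
  abs_integral_mul_le hk fun _ => hM _

lemma continuous_integral_mul {N : ℕ} {X : Type*} [TopologicalSpace X] [FirstCountableTopology X]
    {k : RN N → ℝ} {g : X → RN N → ℝ} {M : ℝ} (hk : Integrable k)
    (hg : Continuous (Function.uncurry g)) (hM : ∀ a z, |g a z| ≤ M) :
    Continuous fun a => ∫ z, k z * g a z := by
  refine continuous_of_dominated (bound := fun z => |k z| * M) (fun a => ?_) (fun a => ?_)
    (hk.abs.mul_const M) (Eventually.of_forall fun z => ?_)
  · exact hk.aestronglyMeasurable.mul
      (hg.comp (Continuous.prodMk_right a)).aestronglyMeasurable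
  · refine Eventually.of_forall fun z => ?_
    rw [norm_mul]
    exact mul_le_mul_of_nonneg_left (hM a z) (abs_nonneg _)
  · exact continuous_const.mul (hg.comp (Continuous.prodMk_left z))

lemma continuous_avg {N : ℕ} {X : Type*} [TopologicalSpace X] [FirstCountableTopology X]
    {k : RN N → ℝ} {g : RN N × ℝ → ℝ} {M : ℝ} (hk : Integrable k) (hg : Continuous g)
    (hM : ∀ q, |g q| ≤ M) {ρ τ : X → ℝ} {x : X → RN N} (hρ : Continuous ρ) (hτ : Continuous τ)
    (hx : Continuous x) : Continuous fun a => avg k (fun y => g (y, τ a)) (ρ a) (x a) := by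
  unfold avg
  refine continuous_integral_mul (M := M) hk ?_ fun a z => hM _
  unfold Function.uncurry
  fun_prop

lemma continuous_avg' {N : ℕ} {X : Type*} [TopologicalSpace X] [FirstCountableTopology X]
    {k : RN N → ℝ} {g : RN N → ℝ} {M : ℝ} (hk : Integrable k) (hg : Continuous g)
    (hM : ∀ q, |g q| ≤ M) {ρ : X → ℝ} {x : X → RN N} (hρ : Continuous ρ)
    (hx : Continuous x) : Continuous fun a => avg k g (ρ a) (x a) :=
  continuous_avg (g := fun q => g q.1) hk (by fun_prop) (fun q => hM _) hρ
    (continuous_const (y := (0 : ℝ))) hx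

lemma hasFDerivAt_integral_form {N : ℕ} {α : Type*} [MeasurableSpace α] {μ : Measure α}
    {F : RN N → α → ℝ} {F' : Fin N → RN N → α → ℝ} {bound : α → ℝ} (x₀ : RN N)
    (hF_meas : ∀ x, AEStronglyMeasurable (F x) μ) (hF_int : Integrable (F x₀) μ)
    (hF'_meas : ∀ i, AEStronglyMeasurable (F' i x₀) μ)
    (h_bound : ∀ i, ∀ᵐ a ∂μ, ∀ x, |F' i x a| ≤ bound a) (hb : Integrable bound μ)
    (h_diff : ∀ᵐ a ∂μ, ∀ x, HasFDerivAt (F · a) (formOf fun i => F' i x a) x) :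
    HasFDerivAt (fun x => ∫ a, F x a ∂μ) (formOf fun i => ∫ a, F' i x₀ a ∂μ) x₀ := by
  have hinteg : ∀ i, Integrable (F' i x₀) μ := fun i =>
    hb.mono' (hF'_meas i) ((h_bound i).mono fun a ha => ha x₀)
  have h := hasFDerivAt_integral_of_dominated_of_fderiv_le (μ := μ) (F := F) (x₀ := x₀)
    (F' := fun x a => formOf fun i => F' i x a) (bound := fun a => N * bound a) univ_mem
    (Eventually.of_forall hF_meas) hF_int ?_ ?_ (hb.const_mul _)
    (h_diff.mono fun a ha x _ => ha x)
  · refine h.congr_fderiv ?_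
    simp only [formOf]
    rw [integral_finsetSum _ fun i _ => (hinteg i).smul_const _]
    exact Finset.sum_congr rfl fun i _ => integral_smul_const _ _
  · simp only [formOf]
    exact Finset.aestronglyMeasurable_fun_sum _ fun i _ => (hF'_meas i).smul_const _
  · filter_upwards [ae_all_iff.2 h_bound] with a ha x _
    refine (norm_formOf_le _).trans ((Finset.sum_le_sum fun i _ => ha i x).trans ?_)
    simp

/-- Averaging against a smooth weight makes bounded continuous functions differentiable. -/
lemma hasFDerivAt_avg {N : ℕ} {k : RN N → ℝ} {k' : Fin N → RN N → ℝ}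
    (hk : Integrable k) (hk' : ∀ i, Integrable (k' i))
    (hd : ∀ z, HasFDerivAt k (-formOf fun i => k' i z) z) {g : RN N → ℝ} {M : ℝ}
    (hg : Continuous g) (hM : ∀ x, |g x| ≤ M) {ρ : ℝ} (hρ : ρ ≠ 0) (x : RN N) :
    HasFDerivAt (avg k g ρ) (formOf fun i => ρ⁻¹ * avg (k' i) g ρ x) x := by
  refine hasFDerivAt_of_gateaux (Ψ := fun x => formOf fun i => ρ⁻¹ * avg (k' i) g ρ x) ?_ ?_ x
  · exact continuous_formOf fun i => continuous_const.mul
      (continuous_avg' (hk' i) hg hM continuous_const continuous_id)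
  intro x v
  set K : RN N → ℝ := fun z => ∑ i, k' i z * v i with hK
  have hKint : Integrable K := integrable_finsetSum _ fun i _ => (hk' i).mul_const _
  have hprim : ∀ z : RN N, ∀ y : ℝ, HasDerivAt (fun y => ∫ σ in (0:ℝ)..y, g (x + σ • v + ρ • z))
      (g (x + y • v + ρ • z)) y := fun z y =>
    intervalIntegral.integral_hasDerivAt_right
      (Continuous.intervalIntegrable (by fun_prop) _ _)
      (Continuous.stronglyMeasurableAtFilter (by fun_prop) _ _)
      (Continuous.continuousAt (by fun_prop))
  have hFle : ∀ z s, |∫ σ in (0:ℝ)..s, g (x + σ • v + ρ • z)| ≤ M * |s| := fun z s => by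
    simpa using intervalIntegral.norm_integral_le_of_norm_le_const (a := 0) (b := s)
      (f := fun σ => g (x + σ • v + ρ • z)) (C := M) fun σ _ => hM _
  have hFcont : ∀ s : ℝ, Continuous fun z : RN N => ∫ σ in (0:ℝ)..s, g (x + σ • v + ρ • z) :=
    fun s => intervalIntegral.continuous_parametric_intervalIntegral_of_continuous'
      (by unfold Function.uncurry; fun_prop) _ _
  have hparts : ∀ s : ℝ, ρ * (avg k g ρ (x + s • v) - avg k g ρ x)
      = ∫ z, K z * ∫ σ in (0:ℝ)..s, g (x + σ • v + ρ • z) := by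
    intro s
    have hline : ∀ z, HasLineDerivAt ℝ (fun z => ∫ σ in (0:ℝ)..s, g (x + σ • v + ρ • z))
        (ρ * (g (x + s • v + ρ • z) - g (x + ρ • z))) z v := by
      intro z
      have h1 : HasDerivAt (fun τ : ℝ => s + ρ * τ) ρ 0 := by
        simpa using ((hasDerivAt_id (0:ℝ)).const_mul ρ).const_add s
      have h2 : HasDerivAt (fun τ : ℝ => ρ * τ) ρ 0 := by
        simpa using ((hasDerivAt_id (0:ℝ)).const_mul ρ)
      have h3 := (HasDerivAt.comp (0:ℝ) (hprim z (s + ρ * 0)) h1).sub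
        (HasDerivAt.comp (0:ℝ) (hprim z (ρ * 0)) h2)
      unfold HasLineDerivAt
      refine (h3.congr_deriv (by simp; ring)).congr_of_eventuallyEq
        (Eventually.of_forall fun τ => ?_)
      simp only [Function.comp, Pi.sub_apply]
      rw [intervalIntegral.integral_interval_sub_left
        (Continuous.intervalIntegrable (by fun_prop) _ _)
        (Continuous.intervalIntegrable (by fun_prop) _ _)]
      have := intervalIntegral.integral_comp_add_right (a := 0) (b := s)
        (fun σ => g (x + σ • v + ρ • z)) (ρ * τ)
      rw [zero_add] at this
      rw [← this]
      refine intervalIntegral.integral_congr fun σ _ => ?_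
      congr 1
      module
    have hkline : ∀ z, HasLineDerivAt ℝ k (-K z) z v := fun z => by
      have := (hd z).hasLineDerivAt v
      simpa using this
    have hi1 : Integrable fun z => K z * ∫ σ in (0:ℝ)..s, g (x + σ • v + ρ • z) :=
      integrable_mul_bounded hKint (hFcont s) fun z => hFle z s
    have hi2 : Integrable fun z => k z * (ρ * (g (x + s • v + ρ • z) - g (x + ρ • z))) := by
      refine integrable_mul_bounded (M := |ρ| * (M + M)) hk (by fun_prop) fun z => ?_
      rw [abs_mul]
      exact mul_le_mul_of_nonneg_left ((abs_sub _ _).trans (add_le_add (hM _) (hM _))) (abs_nonneg _)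
    have hi3 : Integrable fun z => k z * ∫ σ in (0:ℝ)..s, g (x + σ • v + ρ • z) :=
      integrable_mul_bounded hk (hFcont s) fun z => hFle z s
    have hp := integral_bilinear_hasLineDerivAt_right_eq_neg_left_of_integrable
      (μ := (volume : Measure (RN N)))
      (B := ContinuousLinearMap.mul ℝ ℝ) (f := k) (f' := fun z => -K z)
      (g := fun z => ∫ σ in (0:ℝ)..s, g (x + σ • v + ρ • z))
      (g' := fun z => ρ * (g (x + s • v + ρ • z) - g (x + ρ • z))) (v := v)
      (by simpa using hi1.neg) (by simpa using hi2) (by simpa using hi3)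
      (fun z _ => hkline z) (fun z _ => hline z)
    simp only [ContinuousLinearMap.mul_apply', neg_mul, integral_neg, neg_neg] at hp
    rw [← hp, avg, avg, ← integral_sub (integrable_mul_bounded hk (by fun_prop) fun z => hM _)
      (integrable_mul_bounded hk (by fun_prop) fun z => hM _), ← integral_const_mul]
    exact integral_congr_ae (Eventually.of_forall fun z => by dsimp only; ring)
  have hder : HasDerivAt (fun s : ℝ => ∫ z, K z * ∫ σ in (0:ℝ)..s, g (x + σ • v + ρ • z))
      (∫ z, K z * g (x + (0:ℝ) • v + ρ • z)) 0 := by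
    refine (hasDerivAt_integral_of_dominated_loc_of_deriv_le (μ := volume)
      (F' := fun s z => K z * g (x + s • v + ρ • z)) (bound := fun z => |K z| * M) univ_mem
      (Eventually.of_forall fun s => ?_) ?_ ?_ ?_ (hKint.abs.mul_const M) ?_).2
    · exact hKint.aestronglyMeasurable.mul (hFcont s).aestronglyMeasurable
    · exact integrable_mul_bounded hKint (hFcont 0) fun z => hFle z 0
    · exact (integrable_mul_bounded hKint (by fun_prop) fun z => hM _).aestronglyMeasurable
    · refine Eventually.of_forall fun z s _ => ?_
      rw [norm_mul]
      exact mul_le_mul_of_nonneg_left (hM _) (abs_nonneg _)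
    · exact Eventually.of_forall fun z s _ => (hprim z s).const_mul _
  have h4 := (hder.const_mul ρ⁻¹).add_const (avg k g ρ x)
  refine (h4.congr_deriv ?_).congr_of_eventuallyEq (Eventually.of_forall fun s => ?_)
  · rw [formOf_apply]
    simp only [zero_smul, add_zero, hK, Finset.sum_mul, avg]
    rw [integral_finsetSum, Finset.mul_sum]
    · refine Finset.sum_congr rfl fun i _ => ?_
      rw [mul_assoc, ← integral_mul_const]
      congr 2
      ext z
      ring
    · intro i _
      exact integrable_mul_bounded ((hk' i).mul_const _) (by fun_prop) fun z => hM _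
  · dsimp only
    rw [← hparts s]
    field_simp
    ring

lemma hasFDerivAt_avg_of_deriv {N : ℕ} {k : RN N → ℝ} (hk : Integrable k) {g : RN N → ℝ}
    {g' : Fin N → RN N → ℝ} {M : ℝ} (hg : Continuous g) (hM : ∀ x, |g x| ≤ M)
    (hg' : ∀ i, Continuous (g' i)) (hM' : ∀ i x, |g' i x| ≤ M)
    (hd : ∀ x, HasFDerivAt g (formOf fun i => g' i x) x) (ρ : ℝ) (x : RN N) :
    HasFDerivAt (avg k g ρ) (formOf fun i => avg k (g' i) ρ x) x := by
  unfold avg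
  refine hasFDerivAt_integral_form (bound := fun z => |k z| * M)
    (F' := fun i x z => k z * g' i (x + ρ • z)) x (fun x => ?_) ?_ (fun i => ?_) (fun i => ?_)
    (hk.abs.mul_const M) ?_
  · exact (integrable_mul_bounded hk (by fun_prop) fun z => hM _).aestronglyMeasurable
  · exact integrable_mul_bounded hk (by fun_prop) fun z => hM _
  · exact (integrable_mul_bounded hk (by fun_prop) fun z => hM' i _).aestronglyMeasurable
  · refine Eventually.of_forall fun z x => ?_
    rw [abs_mul]
    exact mul_le_mul_of_nonneg_left (hM' i _) (abs_nonneg _)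
  · refine Eventually.of_forall fun z x => ?_
    have h1 : HasFDerivAt (fun x : RN N => x + ρ • z) (ContinuousLinearMap.id ℝ (RN N)) x :=
      (hasFDerivAt_id x).add_const _
    refine (((hd (x + ρ • z)).comp x h1).const_mul (k z)).congr_fderiv ?_
    refine clm_ext_single fun i => ?_
    rw [formOf_single, ContinuousLinearMap.comp_id, smul_apply, formOf_single, smul_eq_mul]

/-- Integration by parts: derivatives can be moved from the weight to the averaged function. -/
lemma avg_deriv_eq {N : ℕ} {k : RN N → ℝ} {k' : Fin N → RN N → ℝ}
    (hk : Integrable k) (hk' : ∀ i, Integrable (k' i))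
    (hd : ∀ z, HasFDerivAt k (-formOf fun i => k' i z) z) {g : RN N → ℝ}
    {g' : Fin N → RN N → ℝ} {M : ℝ} (hg : Continuous g) (hM : ∀ x, |g x| ≤ M)
    (hg' : ∀ i, Continuous (g' i)) (hM' : ∀ i x, |g' i x| ≤ M)
    (hgd : ∀ x, HasFDerivAt g (formOf fun i => g' i x) x) {ρ : ℝ} (hρ : ρ ≠ 0) (x : RN N)
    (i : Fin N) : avg (k' i) g ρ x = ρ * avg k (g' i) ρ x := by
  have h1 := pd_eq_of_hasFDerivAt (hasFDerivAt_avg hk hk' hd hg hM hρ x) i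
  have h2 := pd_eq_of_hasFDerivAt (hasFDerivAt_avg_of_deriv hk hg hM hg' hM' hgd ρ x) i
  rw [← h2, h1, mul_inv_cancel_left₀ hρ]

lemma integral_gaussD2 {N : ℕ} (i j : Fin N) : ∫ z, gaussD2 i j z = 0 := by
  have := avg_deriv_eq (g := fun _ => 1) (g' := fun _ _ => 0) (M := 1) (integrable_gaussD1 i)
    (integrable_gaussD2 i) (hasFDerivAt_gaussD1 i) continuous_const (by simp)
    (fun _ => continuous_const) (by simp)
    (fun x => (hasFDerivAt_const (1:ℝ) x).congr_fderiv (by simp [formOf])) one_ne_zero 0 j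
  simpa [avg] using this

/-- The weight `Δφ`. -/
def gaussL {N : ℕ} (z : RN N) : ℝ := ∑ i, gaussD2 i i z

lemma gaussL_eq {N : ℕ} (z : RN N) : gaussL z = (∑ i, z i ^ 2 - N) * gaussD z := by
  simp [gaussL, gaussD2, ← Finset.sum_mul, Finset.sum_sub_distrib, sq]

lemma integrable_gaussL {N : ℕ} : Integrable (gaussL (N := N)) :=
  integrable_finsetSum _ fun i _ => integrable_gaussD2 i i

lemma avg_eq_dilation {N : ℕ} (k g : RN N → ℝ) {b : ℝ} (hb : 0 < b) (x : RN N) :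
    avg k g b⁻¹ x = ∫ y, b ^ N * k (b • y) * g (x + y) := by
  have h := Measure.integral_comp_smul (volume : Measure (RN N))
    (fun y => b ^ N * k (b • y) * g (x + y)) b⁻¹
  simp only [Module.finrank_fin_fun, smul_smul, mul_inv_cancel₀ hb.ne', one_smul] at h
  rw [inv_pow, inv_inv, abs_of_pos (pow_pos hb N), smul_eq_mul] at h
  simp only [mul_assoc, integral_const_mul] at h ⊢
  exact mul_left_cancel₀ (pow_pos hb N).ne' h

/-- The average against the Gaussian solves the heat equation, in the scale variable. -/
lemma hasDerivAt_avg_scale {N : ℕ} {g : RN N → ℝ} {M : ℝ} (hg : Continuous g)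
    (hM : ∀ x, |g x| ≤ M) {ρ : ℝ} (hρ : 0 < ρ) (x : RN N) :
    HasDerivAt (fun ρ => avg gaussD g ρ x) (ρ⁻¹ * avg gaussL g ρ x) ρ := by
  have hM0 : 0 ≤ M := (abs_nonneg _).trans (hM 0)
  have key : ∀ b : ℝ, 0 < b → HasDerivAt (fun b : ℝ => ∫ y, b ^ N * gaussD (b • y) * g (x + y))
      (-(b⁻¹ * avg gaussL g b⁻¹ x)) b := by
    intro b hb
    set c : ℝ := (√(2 * Real.pi))⁻¹ ^ N with hc
    have hc0 : 0 ≤ c := by positivity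
    have hform : ∀ (b : ℝ) (y : RN N),
        gaussD (b • y) = c * Real.exp (-(b ^ 2 * ∑ i, y i ^ 2) / 2) := by
      intro b y
      simp only [gaussD, Pi.smul_apply, smul_eq_mul, mul_pow, Finset.mul_sum, hc]
    have hderiv : ∀ (b : ℝ) (y : RN N), HasDerivAt (fun b : ℝ => b ^ N * gaussD (b • y) * g (x + y))
        ((N * b ^ (N - 1) - b ^ N * (b * ∑ i, y i ^ 2)) * gaussD (b • y) * g (x + y)) b := by
      intro b y
      simp only [hform]
      have h1 : HasDerivAt (fun b : ℝ => -(b ^ 2 * ∑ i, y i ^ 2) / 2) (-(b * ∑ i, y i ^ 2)) b := by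
        have := (((hasDerivAt_pow 2 b).mul_const (∑ i, y i ^ 2)).neg).div_const 2
        exact this.congr_deriv (by push_cast; ring)
      exact (((hasDerivAt_pow N b).mul (h1.exp.const_mul c)).mul_const _).congr_deriv (by ring)
    have hsum : ∀ y : RN N, ∑ i, y i ^ 2 ≤ N * ‖y‖ ^ 2 := by
      intro y
      refine (Finset.sum_le_sum (g := fun _ => ‖y‖ ^ 2) fun i _ => ?_).trans (by simp)
      rw [← sq_abs (y i)]
      exact pow_le_pow_left₀ (abs_nonneg _) (norm_le_pi_norm y i) 2
    have hbound : Integrable fun y : RN N => (N * (2 * b) ^ (N - 1) * c * M) *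
        (‖y‖ ^ 0 * Real.exp (-(b ^ 2 / 8) * ∑ i, y i ^ 2)) + ((2 * b) ^ N * (2 * b) * N * c * M) *
        (‖y‖ ^ 2 * Real.exp (-(b ^ 2 / 8) * ∑ i, y i ^ 2)) :=
      ((integrable_pow_mul_exp (by positivity) 0).const_mul _).add
        ((integrable_pow_mul_exp (by positivity) 2).const_mul _)
    have hmeas : ∀ b : ℝ, Continuous fun y : RN N => b ^ N * gaussD (b • y) * g (x + y) := by
      intro b
      have := continuous_gaussD (N := N)
      fun_prop
    have h := (hasDerivAt_integral_of_dominated_loc_of_deriv_le (μ := volume)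
      (F := fun (b : ℝ) (y : RN N) => b ^ N * gaussD (b • y) * g (x + y))
      (Ioo_mem_nhds (show b / 2 < b by linarith) (show b < 2 * b by linarith))
      (Eventually.of_forall fun b => (hmeas b).aestronglyMeasurable) ?_ ?_ ?_ hbound
      (Eventually.of_forall fun y b _ => hderiv b y)).2
    · refine h.congr_deriv ?_
      rw [avg_eq_dilation _ _ hb, ← integral_const_mul, ← integral_neg]
      refine integral_congr_ae (Eventually.of_forall fun y => ?_)
      simp only [gaussL_eq, Pi.smul_apply, smul_eq_mul, mul_pow, ← Finset.mul_sum]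
      have : (N : ℝ) * b ^ (N - 1) = b⁻¹ * (N * b ^ N) := by
        rcases N with _ | n
        · simp
        · rw [Nat.add_sub_cancel, pow_succ]; field_simp
      rw [this]
      field_simp
      ring
    · refine integrable_mul_bounded (k := fun y => b ^ N * gaussD (b • y)) ?_ (by fun_prop)
        fun y => hM _
      exact (integrable_gaussD.comp_smul hb.ne').const_mul _
    · have := continuous_gaussD (N := N)
      exact Continuous.aestronglyMeasurable (by fun_prop)
    · refine Eventually.of_forall fun y b' hb' => ?_
      have hb0 : 0 < b' := by linarith [hb'.1]
      have hS0 : 0 ≤ ∑ i, y i ^ 2 := Finset.sum_nonneg fun i _ => sq_nonneg _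
      have he : gaussD (b' • y) ≤ c * Real.exp (-(b ^ 2 / 8) * ∑ i, y i ^ 2) := by
        rw [hform]
        gcongr
        have : b ^ 2 / 4 ≤ b' ^ 2 := by nlinarith [hb'.1]
        nlinarith
      have hp : |(N : ℝ) * b' ^ (N - 1) - b' ^ N * (b' * ∑ i, y i ^ 2)|
          ≤ N * (2 * b) ^ (N - 1) + (2 * b) ^ N * (2 * b * (N * ‖y‖ ^ 2)) := by
        refine (abs_sub _ _).trans ?_
        rw [abs_of_nonneg (by positivity), abs_of_nonneg (by positivity)]
        have := hb'.2.le
        gcongr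
        exact hsum y
      rw [norm_mul, norm_mul, Real.norm_eq_abs, Real.norm_eq_abs, Real.norm_eq_abs,
        abs_of_nonneg (gaussD_nonneg (b' • y))]
      calc _ ≤ (N * (2 * b) ^ (N - 1) + (2 * b) ^ N * (2 * b * (N * ‖y‖ ^ 2)))
            * (c * Real.exp (-(b ^ 2 / 8) * ∑ i, y i ^ 2)) * M := by
              gcongr
              · exact gaussD_nonneg _
              · exact hM _
        _ = _ := by ring
  have h1 := (key ρ⁻¹ (inv_pos.2 hρ)).comp ρ (hasDerivAt_inv hρ.ne')
  refine (h1.congr_deriv ?_).congr_of_eventuallyEq ?_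
  · rw [inv_inv]; field_simp
  · filter_upwards [lt_mem_nhds hρ] with r hr
    simp only [Function.comp]
    rw [← avg_eq_dilation _ _ (inv_pos.2 hr), inv_inv]

lemma intervalIntegral_congr_Ioc {f g : ℝ → ℝ} {a b : ℝ} (hab : a ≤ b)
    (h : ∀ x ∈ Ioc a b, f x = g x) : ∫ x in a..b, f x = ∫ x in a..b, g x := by
  rw [intervalIntegral.integral_of_le hab, intervalIntegral.integral_of_le hab]
  exact setIntegral_congr_fun measurableSet_Ioc h

/-- A singular weight bound used in Duhamel integrals. -/
lemma abs_inv_mul_le {e C β σ : ℝ} (hσ : 0 < σ) (he : |e| ≤ C * √(2 * σ) ^ β) :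
    |(2 * σ)⁻¹ * e| ≤ C * (2 * σ) ^ (β / 2 - 1) := by
  rw [abs_mul, abs_of_pos (by positivity)]
  have h2 : 0 < 2 * σ := by positivity
  calc (2 * σ)⁻¹ * |e| ≤ (2 * σ)⁻¹ * (C * √(2 * σ) ^ β) := by gcongr
    _ = _ := by
      rw [Real.sqrt_eq_rpow, ← Real.rpow_mul h2.le, Real.rpow_sub h2, Real.rpow_one]
      field_simp

lemma intervalIntegrable_two_mul_rpow {β : ℝ} (hβ : 0 < β) (C a b : ℝ) :
    IntervalIntegrable (fun σ : ℝ => C * (2 * σ) ^ (β / 2 - 1)) volume a b := by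
  have := (intervalIntegral.intervalIntegrable_rpow' (a := 2 * a) (b := 2 * b)
    (r := β / 2 - 1) (by linarith)).comp_mul_left (c := 2)
  simpa using this.const_mul C

lemma sqrt_scale_integrable {e : ℝ → ℝ} {C β : ℝ} (hβ : 0 < β)
    (he : ContinuousOn e (Ioi 0)) (hb : ∀ ρ > 0, |e ρ| ≤ C * ρ ^ β) {s : ℝ} (hs : 0 ≤ s) :
    IntervalIntegrable (fun σ => (2 * σ)⁻¹ * e √(2 * σ)) volume 0 s := by
  refine (intervalIntegrable_two_mul_rpow hβ C 0 s).mono_fun' ?_ ?_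
  · rw [uIoc_of_le hs]
    refine ContinuousOn.aestronglyMeasurable ?_ measurableSet_Ioc
    refine ContinuousOn.mul (ContinuousOn.inv₀ (by fun_prop) fun x hx => ?_)
      (he.comp (by fun_prop) fun x hx => ?_)
    · have := hx.1; positivity
    · have := hx.1; show 0 < √(2 * x); positivity
  · rw [uIoc_of_le hs]
    filter_upwards [ae_restrict_mem measurableSet_Ioc] with σ hσ
    exact abs_inv_mul_le hσ.1 (hb _ (by have := hσ.1; positivity))

/-- Fundamental theorem of calculus in the variable `σ = ρ² / 2`. -/
lemma sqrt_scale_eq {c e : ℝ → ℝ} {C β : ℝ} (hβ : 0 < β) (hc : Continuous c)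
    (he : ContinuousOn e (Ioi 0)) (hd : ∀ ρ > 0, HasDerivAt c (ρ⁻¹ * e ρ) ρ)
    (hb : ∀ ρ > 0, |e ρ| ≤ C * ρ ^ β) {s : ℝ} (hs : 0 ≤ s) :
    ∫ σ in (0:ℝ)..s, (2 * σ)⁻¹ * e √(2 * σ) = c √(2 * s) - c 0 := by
  have := intervalIntegral.integral_eq_sub_of_hasDerivAt_of_le hs
    (f := fun σ => c √(2 * σ)) (f' := fun σ => (2 * σ)⁻¹ * e √(2 * σ)) (by fun_prop)
    (fun σ hσ => ?_) (sqrt_scale_integrable hβ he hb hs)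
  · simpa using this
  · have hσ0 : 0 < 2 * σ := by have := hσ.1; positivity
    have h1 : HasDerivAt (fun σ => √(2 * σ)) (1 / (2 * √(2 * σ)) * 2) σ :=
      (Real.hasDerivAt_sqrt hσ0.ne').comp σ (by simpa using (hasDerivAt_id σ).const_mul 2)
    refine ((hd _ (Real.sqrt_pos.2 hσ0)).comp σ h1).congr_deriv ?_
    have h3 := Real.sq_sqrt hσ0.le
    have h4 := Real.sqrt_pos.2 hσ0
    generalize √(2 * σ) = R at h3 h4 ⊢
    rw [← h3]
    field_simp

lemma image_sub_sq {s : ℝ} (hs : 0 < s) : (fun θ : ℝ => s * (1 - θ ^ 2)) '' Ioo 0 1 = Ioo 0 s := by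
  ext r
  constructor
  · rintro ⟨θ, hθ, rfl⟩
    have : θ ^ 2 < 1 := by nlinarith [hθ.1, hθ.2]
    have : 0 < θ ^ 2 := pow_pos hθ.1 2
    constructor
    · exact mul_pos hs (by linarith)
    · show s * (1 - θ ^ 2) < s
      nlinarith
  · intro hr
    have h1 : 0 < 1 - r / s := by rw [sub_pos, div_lt_one hs]; exact hr.2
    have h2 : 0 < r / s := div_pos hr.1 hs
    refine ⟨√(1 - r / s), ⟨Real.sqrt_pos.2 h1, ?_⟩, ?_⟩
    · rw [Real.sqrt_lt' one_pos]; linarith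
    · show s * (1 - √(1 - r / s) ^ 2) = r
      rw [Real.sq_sqrt h1.le]
      field_simp
      ring

/-- The substitution `r = s (1 - θ²)`. -/
lemma integral_sub_sq (G : ℝ → ℝ) {s : ℝ} (hs : 0 ≤ s) :
    ∫ r in (0:ℝ)..s, G r = ∫ θ in (0:ℝ)..1, 2 * s * θ * G (s * (1 - θ ^ 2)) := by
  rcases hs.eq_or_lt with rfl | hs
  · simp
  rw [intervalIntegral.integral_of_le hs.le, intervalIntegral.integral_of_le zero_le_one,
    integral_Ioc_eq_integral_Ioo, integral_Ioc_eq_integral_Ioo, ← image_sub_sq hs,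
    integral_image_eq_integral_abs_deriv_smul (f' := fun θ => s * (-(2 * θ))) measurableSet_Ioo]
  · refine setIntegral_congr_fun measurableSet_Ioo fun θ hθ => ?_
    have : 0 ≤ 2 * s * θ := by have := hθ.1; positivity
    simp only [smul_eq_mul]
    rw [show s * (-(2 * θ)) = -(2 * s * θ) by ring, abs_neg, abs_of_nonneg this]
  · intro θ _
    have := ((hasDerivAt_pow 2 θ).const_sub 1).const_mul s
    exact (this.congr_deriv (by push_cast; ring)).hasDerivWithinAt
  · intro a ha b hb hab
    have h1 : a ^ 2 = b ^ 2 := by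
      have : s * (1 - a ^ 2) = s * (1 - b ^ 2) := hab
      have := mul_left_cancel₀ hs.ne' this
      linarith
    exact (pow_left_inj₀ ha.1.le hb.1.le two_ne_zero).1 h1

lemma integral_triangle_swap {e : ℝ → ℝ → ℝ} {C β t : ℝ} (hβ : 0 < β)
    (he : Continuous (Function.uncurry e)) (hb : ∀ ρ > 0, ∀ r, |e ρ r| ≤ C * ρ ^ β)
    (ht : 0 ≤ t) :
    IntervalIntegrable (fun s => ∫ r in (0:ℝ)..s, (2 * (s - r))⁻¹ * e √(2 * (s - r)) r) volume 0 t ∧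
    ∫ s in (0:ℝ)..t, ∫ r in (0:ℝ)..s, (2 * (s - r))⁻¹ * e √(2 * (s - r)) r
      = ∫ r in (0:ℝ)..t, ∫ s in r..t, (2 * (s - r))⁻¹ * e √(2 * (s - r)) r := by
  set S : Set (ℝ × ℝ) := {p | 0 < p.2 ∧ p.2 < p.1 ∧ p.1 < t} with hS
  have hSm : MeasurableSet S := by
    refine IsOpen.measurableSet ?_
    exact (isOpen_lt continuous_const continuous_snd).inter
      ((isOpen_lt continuous_snd continuous_fst).inter (isOpen_lt continuous_fst continuous_const))
  set k : ℝ × ℝ → ℝ := fun p => (2 * (p.1 - p.2))⁻¹ * e √(2 * (p.1 - p.2)) p.2 with hk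
  have hkc : ContinuousOn k S := by
    refine ContinuousOn.mul (ContinuousOn.inv₀ (by fun_prop) fun p hp => ?_) ?_
    · have : 0 < p.1 - p.2 := sub_pos.2 hp.2.1
      positivity
    · exact Continuous.continuousOn (he.comp (by fun_prop :
        Continuous fun p : ℝ × ℝ => (√(2 * (p.1 - p.2)), p.2)))
  have hinteg : Integrable (S.indicator k) (volume.prod volume) := by
    have hψ : Integrable ((Ioo 0 t).indicator fun σ : ℝ => C * (2 * σ) ^ (β / 2 - 1)) := by
      rw [integrable_indicator_iff measurableSet_Ioo]
      exact ((intervalIntegrable_iff_integrableOn_Ioo_of_le ht).1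
        (intervalIntegrable_two_mul_rpow hβ C 0 t))
    have hf : Integrable ((Ioo 0 t).indicator fun _ : ℝ => (1 : ℝ)) := by
      rw [integrable_indicator_iff measurableSet_Ioo]
      simp
    have hconv := Integrable.convolution_integrand (ContinuousLinearMap.mul ℝ ℝ) hf hψ
      (μ := volume) (ν := volume)
    refine hconv.mono' ?_ (Eventually.of_forall fun p => ?_)
    · rw [aestronglyMeasurable_indicator_iff hSm]
      exact hkc.aestronglyMeasurable hSm
    · by_cases hp : p ∈ S
      · have hp1 : 0 < p.1 - p.2 := sub_pos.2 hp.2.1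
        rw [indicator_of_mem hp, ContinuousLinearMap.mul_apply', indicator_of_mem, one_mul,
          indicator_of_mem]
        · exact abs_inv_mul_le hp1 (hb _ (by positivity) _)
        · exact ⟨hp1, by linarith [hp.1, hp.2.2]⟩
        · exact ⟨hp.1, hp.2.1.trans hp.2.2⟩
      · rw [indicator_of_notMem hp, norm_zero, ContinuousLinearMap.mul_apply']
        refine mul_nonneg (indicator_nonneg (fun _ _ => zero_le_one) _)
          (indicator_nonneg (fun σ hσ => ?_) _)
        have h1 := (abs_nonneg _).trans (hb 1 one_pos 0)
        simp only [Real.one_rpow, mul_one] at h1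
        have := hσ.1
        positivity
  have h1 : (fun s => ∫ r, S.indicator k (s, r))
      = (Ioc 0 t).indicator fun s => if s = t then 0 else ∫ r in (0:ℝ)..s, k (s, r) := by
    funext s
    by_cases hs : s ∈ Ioo 0 t
    · rw [indicator_of_mem (Ioo_subset_Ioc_self hs), if_neg hs.2.ne,
        intervalIntegral.integral_of_le hs.1.le,
        integral_Ioc_eq_integral_Ioo, ← integral_indicator measurableSet_Ioo]
      congr 1
      funext r
      have : (s, r) ∈ S ↔ r ∈ Ioo 0 s :=
        ⟨fun h => ⟨h.1, h.2.1⟩, fun h => ⟨h.1, h.2, hs.2⟩⟩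
      simp only [indicator, this]
    · have h0 : (fun r => S.indicator k (s, r)) = fun _ => 0 := by
        funext r
        exact indicator_of_notMem (fun h => hs ⟨h.1.trans h.2.1, h.2.2⟩) _
      rw [h0, integral_zero]
      by_cases hst : s = t
      · simp [indicator, hst]
      · rw [indicator_of_notMem]
        exact fun h => hs ⟨h.1, lt_of_le_of_ne h.2 hst⟩
  have h2 : (fun r => ∫ s, S.indicator k (s, r))
      = (Ioo 0 t).indicator fun r => ∫ s in r..t, k (s, r) := by
    funext r
    by_cases hr : r ∈ Ioo 0 t
    · rw [indicator_of_mem hr, intervalIntegral.integral_of_le hr.2.le,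
        integral_Ioc_eq_integral_Ioo, ← integral_indicator measurableSet_Ioo]
      congr 1
      funext s
      have : (s, r) ∈ S ↔ s ∈ Ioo r t :=
        ⟨fun h => ⟨h.2.1, h.2.2⟩, fun h => ⟨hr.1, h.1, h.2⟩⟩
      simp only [indicator, this]
    · rw [indicator_of_notMem hr]
      have h0 : (fun s => S.indicator k (s, r)) = fun _ => 0 := by
        funext s
        exact indicator_of_notMem (fun h => hr ⟨h.1, h.2.1.trans h.2.2⟩) _
      rw [h0, integral_zero]
  have hae : (fun s => if s = t then 0 else ∫ r in (0:ℝ)..s, k (s, r))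
      =ᵐ[volume] fun s => ∫ r in (0:ℝ)..s, k (s, r) := by
    filter_upwards [compl_mem_ae_iff.2 (measure_singleton t)] with s hs
    exact if_neg hs
  have hI : Integrable (fun s => ∫ r, S.indicator k (s, r)) := hinteg.integral_prod_left
  have hsw := integral_integral_swap (f := fun s r => S.indicator k (s, r)) hinteg
  rw [h1, h2, integral_indicator measurableSet_Ioc, integral_indicator measurableSet_Ioo,
    integral_congr_ae (ae_restrict_of_ae hae)] at hsw
  rw [h1, integrable_indicator_iff measurableSet_Ioc] at hI
  refine ⟨?_, ?_⟩
  · rw [intervalIntegrable_iff_integrableOn_Ioc_of_le ht]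
    exact hI.congr (ae_restrict_of_ae hae)
  · rw [intervalIntegral.integral_of_le ht, hsw, intervalIntegral.integral_of_le ht,
      integral_Ioc_eq_integral_Ioo]

/-- Time integral form of Duhamel's formula, reduced to calculus in the scale variable. -/
lemma duhamel_time_integral {c e : ℝ → ℝ → ℝ} {C β t : ℝ} (hβ : 0 < β)
    (hc : Continuous (Function.uncurry c)) (he : Continuous (Function.uncurry e))
    (hd : ∀ ρ > 0, ∀ r, HasDerivAt (fun ρ => c ρ r) (ρ⁻¹ * e ρ r) ρ)
    (hb : ∀ ρ > 0, ∀ r, |e ρ r| ≤ C * ρ ^ β) (ht : 0 ≤ t) :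
    ∫ θ in (0:ℝ)..1, 2 * t * θ * c (√(2 * t) * θ) (t * (1 - θ ^ 2))
      = ∫ s in (0:ℝ)..t,
        (c 0 s + ∫ θ in (0:ℝ)..1, θ⁻¹ * e (√(2 * s) * θ) (s * (1 - θ ^ 2))) := by
  have hsq : ∀ {s : ℝ}, 0 ≤ s → ∀ θ ∈ Ioc (0:ℝ) 1, √(2 * (s - s * (1 - θ ^ 2))) = √(2 * s) * θ := by
    intro s hs θ hθ
    rw [show 2 * (s - s * (1 - θ ^ 2)) = (2 * s) * θ ^ 2 by ring, Real.sqrt_mul (by positivity),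
      Real.sqrt_sq hθ.1.le]
  have hL : ∫ θ in (0:ℝ)..1, 2 * t * θ * c (√(2 * t) * θ) (t * (1 - θ ^ 2))
      = ∫ r in (0:ℝ)..t, c √(2 * (t - r)) r := by
    rw [integral_sub_sq _ ht]
    refine intervalIntegral_congr_Ioc zero_le_one fun θ hθ => ?_
    rw [hsq ht θ hθ]
  have hR : ∀ s, 0 < s → ∫ θ in (0:ℝ)..1, θ⁻¹ * e (√(2 * s) * θ) (s * (1 - θ ^ 2))
      = ∫ r in (0:ℝ)..s, (2 * (s - r))⁻¹ * e √(2 * (s - r)) r := by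
    intro s hs
    rw [integral_sub_sq _ hs.le]
    refine intervalIntegral_congr_Ioc zero_le_one fun θ hθ => ?_
    rw [hsq hs.le θ hθ]
    have := hθ.1
    field_simp
    ring
  obtain ⟨hI, hsw⟩ := integral_triangle_swap hβ he hb ht
  have hRI : ∀ s ∈ Ioc 0 t, ∫ θ in (0:ℝ)..1, θ⁻¹ * e (√(2 * s) * θ) (s * (1 - θ ^ 2))
      = ∫ r in (0:ℝ)..s, (2 * (s - r))⁻¹ * e √(2 * (s - r)) r := fun s hs => hR s hs.1
  have hc0 : Continuous fun s => c 0 s := hc.comp (Continuous.prodMk_right 0)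
  have hrhs : ∫ s in (0:ℝ)..t,
        (c 0 s + ∫ θ in (0:ℝ)..1, θ⁻¹ * e (√(2 * s) * θ) (s * (1 - θ ^ 2)))
      = ∫ s in (0:ℝ)..t,
        (c 0 s + ∫ r in (0:ℝ)..s, (2 * (s - r))⁻¹ * e √(2 * (s - r)) r) :=
    intervalIntegral_congr_Ioc ht fun s hs => by rw [hRI s hs]
  rw [hL, hrhs, intervalIntegral.integral_add (hc0.intervalIntegrable _ _) hI, hsw]
  have hin : ∀ r ∈ uIcc 0 t, ∫ s in r..t, (2 * (s - r))⁻¹ * e √(2 * (s - r)) r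
      = c √(2 * (t - r)) r - c 0 r := by
    intro r hr
    rw [uIcc_of_le ht] at hr
    have h1 := intervalIntegral.integral_comp_sub_right (a := r) (b := t)
      (fun σ => (2 * σ)⁻¹ * e √(2 * σ) r) r
    rw [h1, sub_self]
    exact sqrt_scale_eq (c := fun ρ => c ρ r) (e := fun ρ => e ρ r) hβ
      (hc.comp (Continuous.prodMk_left r)) (he.comp (Continuous.prodMk_left r)).continuousOn
      (fun ρ hρ => hd ρ hρ r) (fun ρ hρ => hb ρ hρ r) (sub_nonneg.2 hr.2)
  have hcs : Continuous fun r => c √(2 * (t - r)) r :=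
    hc.comp (by fun_prop : Continuous fun r : ℝ => (√(2 * (t - r)), r))
  rw [intervalIntegral.integral_congr hin, intervalIntegral.integral_sub
    (hcs.intervalIntegrable _ _) (hc0.intervalIntegrable _ _)]
  ring

lemma lipschitz_of_form {N : ℕ} {u : RN N → ℝ} {a : Fin N → RN N → ℝ} {B : ℝ}
    (hd : ∀ x, HasFDerivAt u (formOf fun i => a i x) x) (ha : ∀ i x, |a i x| ≤ B) (x y : RN N) :
    |u x - u y| ≤ N * B * ‖x - y‖ := by
  refine Convex.norm_image_sub_le_of_norm_hasFDerivWithin_le (s := univ)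
    (fun x _ => (hd x).hasFDerivWithinAt) (fun x _ => ?_) convex_univ (mem_univ y) (mem_univ x)
  exact (norm_formOf_le _).trans ((Finset.sum_le_sum fun i _ => ha i x).trans (by simp))

lemma holder_interpolate {w A B d β : ℝ} (hβ : β ∈ Ioo (0:ℝ) 1) (hd : 0 ≤ d) (hA : |w| ≤ A)
    (hB0 : 0 ≤ B) (hB : |w| ≤ B * d) : |w| ≤ (A + B) * d ^ β := by
  have hA0 : 0 ≤ A := (abs_nonneg _).trans hA
  have hdβ : 0 ≤ d ^ β := Real.rpow_nonneg hd β
  rcases le_total d 1 with h | h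
  · have h1 : d ≤ d ^ β := by
      rcases hd.eq_or_lt with rfl | hd
      · exact hdβ
      · simpa using Real.rpow_le_rpow_of_exponent_ge hd h hβ.2.le
    nlinarith
  · have h1 : 1 ≤ d ^ β := Real.one_le_rpow h hβ.1.le
    nlinarith

lemma abs_avg_gaussD2_le {N : ℕ} {g : RN N → ℝ} {M C β : ℝ} (hβ : β ∈ Ioo (0:ℝ) 1)
    (hg : Continuous g) (hM : ∀ x, |g x| ≤ M) (hC : ∀ x y, |g x - g y| ≤ C * ‖x - y‖ ^ β)
    (i j : Fin N) {ρ : ℝ} (hρ : 0 ≤ ρ) (x : RN N) :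
    |avg (gaussD2 i j) g ρ x| ≤ C * (∫ z : RN N, ‖z‖ ^ β * |gaussD2 i j z|) * ρ ^ β := by
  have h1 : avg (gaussD2 i j) g ρ x = ∫ z, gaussD2 i j z * (g (x + ρ • z) - g x) := by
    simp only [mul_sub]
    rw [integral_sub (integrable_mul_bounded (integrable_gaussD2 i j) (by fun_prop) fun z => hM _)
      ((integrable_gaussD2 i j).mul_const _), integral_mul_const, integral_gaussD2, zero_mul,
      sub_zero, avg]
  rw [h1, mul_right_comm, ← integral_const_mul, ← Real.norm_eq_abs]
  refine norm_integral_le_of_norm_le ((integrable_rpow_mul_gaussD2 i j hβ).const_mul _)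
    (Eventually.of_forall fun z => ?_)
  have h2 := hC (x + ρ • z) x
  rw [add_sub_cancel_left, norm_smul, Real.norm_of_nonneg hρ,
    Real.mul_rpow hρ (norm_nonneg _)] at h2
  rw [norm_mul, Real.norm_eq_abs, Real.norm_eq_abs]
  calc _ ≤ |gaussD2 i j z| * (C * (ρ ^ β * ‖z‖ ^ β)) := by gcongr
    _ = _ := by ring

/-- The integral `∫_0^1 c(R,θ) ∫ k(z) g(x + R θ z, t (1 - θ²)) dz dθ` with `R = √(2t)`. -/
def duh {N : ℕ} (c : ℝ → ℝ → ℝ) (k : RN N → ℝ) (g : RN N × ℝ → ℝ) (q : RN N × ℝ) : ℝ :=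
  ∫ θ in (0:ℝ)..1, c √(2 * q.2) θ *
    avg k (fun y => g (y, q.2 * (1 - θ ^ 2))) (√(2 * q.2) * θ) q.1

/-- Duhamel's integral `∫_0^t e^{(t-r)Δ} g(r) dr`. -/
def duhW {N : ℕ} (g : RN N × ℝ → ℝ) (q : RN N × ℝ) : ℝ := duh (fun R θ => R ^ 2 * θ) gaussD g q

/-- First space derivatives of Duhamel's integral. -/
def duhD {N : ℕ} (i : Fin N) (g : RN N × ℝ → ℝ) (q : RN N × ℝ) : ℝ :=
  duh (fun R _ => R) (gaussD1 i) g q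

/-- Second space derivatives of Duhamel's integral. -/
def duhDD {N : ℕ} (i j : Fin N) (g : RN N × ℝ → ℝ) (q : RN N × ℝ) : ℝ :=
  duh (fun _ θ => θ⁻¹) (gaussD2 i j) g q

lemma duh_shift {N : ℕ} (c : ℝ → ℝ → ℝ) (k : RN N → ℝ) (g : RN N × ℝ → ℝ) (a : RN N)
    (q : RN N × ℝ) : duh c k g (q.1 + a, q.2) = duh c k (fun p => g (p.1 + a, p.2)) q := by
  simp only [duh, avg, add_right_comm]

lemma continuous_duh_integrand {N : ℕ} {k : RN N → ℝ} {g : RN N × ℝ → ℝ} {M : ℝ}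
    (hk : Integrable k) (hg : Continuous g) (hM : ∀ q, |g q| ≤ M) :
    Continuous fun p : (RN N × ℝ) × ℝ =>
      avg k (fun y => g (y, p.1.2 * (1 - p.2 ^ 2))) (√(2 * p.1.2) * p.2) p.1.1 :=
  continuous_avg hk hg hM (by fun_prop) (by fun_prop) (by fun_prop)

lemma continuous_duh {N : ℕ} {c : ℝ → ℝ → ℝ} {k : RN N → ℝ} {g : RN N × ℝ → ℝ} {M : ℝ}
    (hk : Integrable k) (hg : Continuous g) (hM : ∀ q, |g q| ≤ M)
    (hc : ∀ θ, Continuous fun R => c R θ) (hcm : ∀ R, Measurable (c R))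
    (hb : ∀ A, ∃ b : ℝ → ℝ, IntervalIntegrable b volume 0 1 ∧ ∀ q : RN N × ℝ, q.2 ≤ A →
      ∀ θ ∈ Ioc (0:ℝ) 1, |c √(2 * q.2) θ *
        avg k (fun y => g (y, q.2 * (1 - θ ^ 2))) (√(2 * q.2) * θ) q.1| ≤ b θ) :
    Continuous (duh c k g) := by
  have hcont := continuous_duh_integrand hk hg hM
  refine continuous_iff_continuousAt.2 fun q₀ => ?_
  obtain ⟨b, hbi, hb⟩ := hb (q₀.2 + 1)
  unfold duh
  refine intervalIntegral.continuousAt_of_dominated_interval (bound := b)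
    (Eventually.of_forall fun q => ?_) ?_ hbi (Eventually.of_forall fun θ _ => ?_)
  · exact ((hcm _).aestronglyMeasurable).mul
      (hcont.comp (Continuous.prodMk_right q)).aestronglyMeasurable
  · have : ∀ᶠ q in 𝓝 q₀, q.2 < q₀.2 + 1 :=
      continuous_snd.continuousAt.eventually_lt continuousAt_const (by simp)
    filter_upwards [this] with q hq
    refine Eventually.of_forall fun θ hθ => ?_
    rw [uIoc_of_le zero_le_one] at hθ
    exact hb q hq.le θ hθ
  · exact (((hc θ).comp (by fun_prop)).mul
      (hcont.comp (Continuous.prodMk_left θ))).continuousAt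

lemma duhW_integrand_le {N : ℕ} {g : RN N × ℝ → ℝ} {M : ℝ}
    (hM : ∀ q, |g q| ≤ M) (q : RN N × ℝ) {θ : ℝ} (hθ : θ ∈ Ioc (0:ℝ) 1) :
    |√(2 * q.2) ^ 2 * θ * avg gaussD (fun y => g (y, q.2 * (1 - θ ^ 2))) (√(2 * q.2) * θ) q.1|
      ≤ √(2 * q.2) ^ 2 * M := by
  have h := abs_avg_le integrable_gaussD (M := M) (fun y => hM (y, q.2 * (1 - θ ^ 2)))
    (√(2 * q.2) * θ) q.1
  have h1 : ∫ z : RN N, |gaussD z| = 1 := by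
    simp only [abs_of_nonneg (gaussD_nonneg _)]
    exact integral_gaussD
  rw [h1, one_mul] at h
  have hθ0 := hθ.1.le
  rw [abs_mul, abs_of_nonneg (by positivity : 0 ≤ √(2 * q.2) ^ 2 * θ)]
  have hM0 : 0 ≤ M := (abs_nonneg _).trans h
  calc _ ≤ √(2 * q.2) ^ 2 * 1 * M := by gcongr; exact hθ.2
    _ = _ := by ring

lemma duhD_integrand_le {N : ℕ} {g : RN N × ℝ → ℝ} {M : ℝ} (i : Fin N)
    (hM : ∀ q, |g q| ≤ M) (q : RN N × ℝ) (θ : ℝ) :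
    |√(2 * q.2) * avg (gaussD1 i) (fun y => g (y, q.2 * (1 - θ ^ 2))) (√(2 * q.2) * θ) q.1|
      ≤ √(2 * q.2) * ((∫ z, |gaussD1 i z|) * M) := by
  rw [abs_mul, abs_of_nonneg (Real.sqrt_nonneg _)]
  exact mul_le_mul_of_nonneg_left (abs_avg_le (integrable_gaussD1 i) (fun y => hM _) _ _)
    (Real.sqrt_nonneg _)

lemma abs_duhW_le {N : ℕ} {g : RN N × ℝ → ℝ} {M : ℝ} (hM : ∀ q, |g q| ≤ M) (q : RN N × ℝ) :
    |duhW g q| ≤ √(2 * q.2) ^ 2 * M := by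
  have := intervalIntegral.norm_integral_le_of_norm_le_const (a := 0) (b := 1)
    (f := fun θ => √(2 * q.2) ^ 2 * θ * avg gaussD (fun y => g (y, q.2 * (1 - θ ^ 2)))
      (√(2 * q.2) * θ) q.1) (C := √(2 * q.2) ^ 2 * M) fun θ hθ =>
    duhW_integrand_le hM q (uIoc_of_le (zero_le_one (α := ℝ)) ▸ hθ)
  rwa [sub_zero, abs_one, mul_one] at this

lemma abs_duhD_le {N : ℕ} {g : RN N × ℝ → ℝ} {M : ℝ} (i : Fin N) (hM : ∀ q, |g q| ≤ M)
    (q : RN N × ℝ) : |duhD i g q| ≤ √(2 * q.2) * ((∫ z, |gaussD1 i z|) * M) := by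
  have := intervalIntegral.norm_integral_le_of_norm_le_const (a := 0) (b := 1)
    (f := fun θ => √(2 * q.2) * avg (gaussD1 i) (fun y => g (y, q.2 * (1 - θ ^ 2)))
      (√(2 * q.2) * θ) q.1) (C := √(2 * q.2) * ((∫ z, |gaussD1 i z|) * M)) fun θ _ =>
    duhD_integrand_le i hM q θ
  rwa [sub_zero, abs_one, mul_one] at this

lemma duh_sub {N : ℕ} {c : ℝ → ℝ → ℝ} {k : RN N → ℝ} {g g' : RN N × ℝ → ℝ} {M : ℝ}
    (hk : Integrable k) (hg : Continuous g) (hM : ∀ q, |g q| ≤ M)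
    (hg' : Continuous g') (hM' : ∀ q, |g' q| ≤ M) (hc : ∀ R, Continuous (c R)) (q : RN N × ℝ) :
    duh c k g q - duh c k g' q = duh c k (fun p => g p - g' p) q := by
  unfold duh
  have h1 : Continuous fun θ => c √(2 * q.2) θ *
      avg k (fun y => g (y, q.2 * (1 - θ ^ 2))) (√(2 * q.2) * θ) q.1 := (hc _).mul <|
    (continuous_duh_integrand hk hg hM).comp (Continuous.prodMk_right q)
  have h2 : Continuous fun θ => c √(2 * q.2) θ *
      avg k (fun y => g' (y, q.2 * (1 - θ ^ 2))) (√(2 * q.2) * θ) q.1 := (hc _).mul <|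
    (continuous_duh_integrand hk hg' hM').comp (Continuous.prodMk_right q)
  rw [← intervalIntegral.integral_sub (h1.intervalIntegrable _ _)
    (h2.intervalIntegrable _ _)]
  congr 1
  funext θ
  rw [← mul_sub, avg, avg, ← integral_sub
    (integrable_mul_bounded hk (by fun_prop) fun z => hM _)
    (integrable_mul_bounded hk (by fun_prop) fun z => hM' _)]
  simp only [avg, mul_sub]

lemma intervalIntegrable_rpow_sub_one {β : ℝ} (hβ : 0 < β) (C : ℝ) :
    IntervalIntegrable (fun θ : ℝ => C * θ ^ (β - 1)) volume 0 1 :=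
  (intervalIntegral.intervalIntegrable_rpow' (by linarith)).const_mul C

lemma duhDD_integrand_le {N : ℕ} {g : RN N × ℝ → ℝ} {M C β A : ℝ} (hβ : β ∈ Ioo (0:ℝ) 1)
    (hg : Continuous g) (hM : ∀ q, |g q| ≤ M)
    (hC : ∀ x y t, |g (x, t) - g (y, t)| ≤ C * ‖x - y‖ ^ β) (hC0 : 0 ≤ C) (i j : Fin N)
    {q : RN N × ℝ} (hq : q.2 ≤ A) {θ : ℝ} (hθ : θ ∈ Ioc (0:ℝ) 1) :
    |θ⁻¹ * avg (gaussD2 i j) (fun y => g (y, q.2 * (1 - θ ^ 2))) (√(2 * q.2) * θ) q.1|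
      ≤ (C * (∫ z : RN N, ‖z‖ ^ β * |gaussD2 i j z|) * √(2 * A) ^ β) * θ ^ (β - 1) := by
  have hθ0 := hθ.1
  have h := abs_avg_gaussD2_le hβ (g := fun y => g (y, q.2 * (1 - θ ^ 2))) (by fun_prop)
    (fun y => hM _) (fun x y => hC x y _) i j (ρ := √(2 * q.2) * θ) (by positivity) q.1
  rw [abs_mul, abs_of_pos (inv_pos.2 hθ0)]
  have hK : 0 ≤ ∫ z : RN N, ‖z‖ ^ β * |gaussD2 i j z| :=
    integral_nonneg fun z => by positivity
  calc _ ≤ θ⁻¹ * (C * (∫ z : RN N, ‖z‖ ^ β * |gaussD2 i j z|) * (√(2 * q.2) * θ) ^ β) := by gcongr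
    _ ≤ θ⁻¹ * (C * (∫ z : RN N, ‖z‖ ^ β * |gaussD2 i j z|) * (√(2 * A) * θ) ^ β) := by
      have := hβ.1
      gcongr
    _ = _ := by
      rw [Real.mul_rpow (Real.sqrt_nonneg _) hθ0.le, Real.rpow_sub_one hθ0.ne']
      ring

lemma continuous_duhW {N : ℕ} {g : RN N × ℝ → ℝ} {M : ℝ} (hg : Continuous g)
    (hM : ∀ q, |g q| ≤ M) : Continuous (duhW g) := by
  refine continuous_duh (c := fun R θ => R ^ 2 * θ) integrable_gaussD hg hM (fun θ => by fun_prop)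
    (fun R => by fun_prop) fun A => ⟨fun _ => √(2 * A) ^ 2 * M, intervalIntegrable_const, ?_⟩
  intro q hq θ hθ
  have hM0 : 0 ≤ M := (abs_nonneg _).trans (hM q)
  refine (duhW_integrand_le hM q hθ).trans ?_
  dsimp only
  gcongr

lemma continuous_duhD {N : ℕ} {g : RN N × ℝ → ℝ} {M : ℝ} (hg : Continuous g)
    (hM : ∀ q, |g q| ≤ M) (i : Fin N) : Continuous (duhD i g) := by
  refine continuous_duh (c := fun R _ => R) (integrable_gaussD1 i) hg hM (fun θ => by fun_prop)
    (fun R => by fun_prop)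
    fun A => ⟨fun _ => √(2 * A) * ((∫ z, |gaussD1 i z|) * M), intervalIntegrable_const, ?_⟩
  intro q hq θ hθ
  have hM0 : 0 ≤ M := (abs_nonneg _).trans (hM q)
  have hK : 0 ≤ ∫ z, |gaussD1 i z| := integral_nonneg fun z => abs_nonneg _
  refine (duhD_integrand_le i hM q θ).trans ?_
  dsimp only
  gcongr

lemma continuous_duhDD {N : ℕ} {g : RN N × ℝ → ℝ} {M C β : ℝ} (hβ : β ∈ Ioo (0:ℝ) 1)
    (hg : Continuous g) (hM : ∀ q, |g q| ≤ M)
    (hC : ∀ x y t, |g (x, t) - g (y, t)| ≤ C * ‖x - y‖ ^ β) (hC0 : 0 ≤ C) (i j : Fin N) :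
    Continuous (duhDD i j g) :=
  continuous_duh (c := fun _ θ => θ⁻¹) (integrable_gaussD2 i j) hg hM (fun θ => by fun_prop)
    (fun R => by fun_prop) fun _ => ⟨_, intervalIntegrable_rpow_sub_one hβ.1 _,
      fun _ hq _ hθ => duhDD_integrand_le hβ hg hM hC hC0 i j hq hθ⟩

lemma hasFDerivAt_duh {N : ℕ} {c c' : ℝ → ℝ → ℝ} {k : RN N → ℝ} {k' : Fin N → RN N → ℝ}
    (hk : Integrable k) (hk' : ∀ i, Integrable (k' i))
    (hd : ∀ z, HasFDerivAt k (-formOf fun i => k' i z) z) {g : RN N × ℝ → ℝ} {M : ℝ}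
    (hg : Continuous g) (hM : ∀ q, |g q| ≤ M) (hc : ∀ R, Continuous (c R))
    (hc' : ∀ R, Measurable (c' R)) (hcc : ∀ R > 0, ∀ θ > 0, c' R θ = c R θ * (R * θ)⁻¹)
    {t : ℝ} (ht : 0 < t) {b : ℝ → ℝ} (hb : IntervalIntegrable b volume 0 1)
    (hb' : ∀ i x, ∀ θ ∈ Ioc (0:ℝ) 1, |c' √(2 * t) θ *
        avg (k' i) (fun y => g (y, t * (1 - θ ^ 2))) (√(2 * t) * θ) x| ≤ b θ) (x : RN N) :
    HasFDerivAt (fun x => duh c k g (x, t)) (formOf fun i => duh c' (k' i) g (x, t)) x := by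
  have hR : 0 < √(2 * t) := by positivity
  simp only [duh, intervalIntegral.integral_of_le (zero_le_one (α := ℝ))]
  have hcont : ∀ {k : RN N → ℝ} (_ : Integrable k) (x : RN N), Continuous fun θ : ℝ =>
      avg k (fun y => g (y, t * (1 - θ ^ 2))) (√(2 * t) * θ) x := fun hk x =>
    (continuous_duh_integrand hk hg hM).comp (Continuous.prodMk_right (x, t))
  refine hasFDerivAt_integral_form (bound := b) (F' := fun i x θ => c' √(2 * t) θ *
        avg (k' i) (fun y => g (y, t * (1 - θ ^ 2))) (√(2 * t) * θ) x) x (fun x => ?_) ?_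
    (fun i => ?_) (fun i => ?_) ?_ ?_
  · exact ((hc _).mul (hcont hk x)).aestronglyMeasurable
  · exact (((hc _).mul (hcont hk x)).intervalIntegrable 0 1).1
  · exact (hc' _).aestronglyMeasurable.mul (hcont (hk' i) x).aestronglyMeasurable
  · filter_upwards [ae_restrict_mem measurableSet_Ioc] with θ hθ x
    exact hb' i x θ hθ
  · exact hb.1
  · filter_upwards [ae_restrict_mem measurableSet_Ioc] with θ hθ x
    have h := (hasFDerivAt_avg hk hk' hd (g := fun y => g (y, t * (1 - θ ^ 2))) (by fun_prop)
      (fun y => hM _) (mul_pos hR hθ.1).ne' x).const_mul (c √(2 * t) θ)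
    refine h.congr_fderiv (clm_ext_single fun i => ?_)
    rw [smul_apply, formOf_single, formOf_single, hcc _ hR _ hθ.1, smul_eq_mul, mul_assoc]

lemma sqrt_two_mul_of_nonpos {t : ℝ} (ht : t ≤ 0) : √(2 * t) = 0 :=
  Real.sqrt_eq_zero_of_nonpos (by linarith)

lemma hasFDerivAt_duhW {N : ℕ} {g : RN N × ℝ → ℝ} {M : ℝ} (hg : Continuous g)
    (hM : ∀ q, |g q| ≤ M) (x : RN N) (t : ℝ) :
    HasFDerivAt (fun x => duhW g (x, t)) (formOf fun i => duhD i g (x, t)) x := by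
  have hM0 : 0 ≤ M := (abs_nonneg _).trans (hM 0)
  rcases le_or_gt t 0 with ht | ht
  · simp only [duhW, duhD, duh, sqrt_two_mul_of_nonpos ht]
    simpa [formOf] using hasFDerivAt_const (0:ℝ) x
  · refine hasFDerivAt_duh (c := fun R θ => R ^ 2 * θ) (c' := fun R _ => R) integrable_gaussD
      integrable_gaussD1 hasFDerivAt_gaussD hg hM (fun R => by fun_prop) (fun R => by fun_prop)
      (fun R hR θ hθ => by field_simp) ht
      (b := fun _ => √(2 * t) * ((∑ i, ∫ z : RN N, |gaussD1 i z|) * M))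
      intervalIntegrable_const (fun i x θ hθ => ?_) x
    refine (duhD_integrand_le i hM (x, t) θ).trans ?_
    gcongr
    exact Finset.single_le_sum (f := fun i => ∫ z : RN N, |gaussD1 i z|)
      (fun i _ => integral_nonneg fun z => abs_nonneg _) (Finset.mem_univ i)

lemma hasFDerivAt_duhD {N : ℕ} {g : RN N × ℝ → ℝ} {M C β : ℝ} (hβ : β ∈ Ioo (0:ℝ) 1)
    (hg : Continuous g) (hM : ∀ q, |g q| ≤ M)
    (hC : ∀ x y t, |g (x, t) - g (y, t)| ≤ C * ‖x - y‖ ^ β) (hC0 : 0 ≤ C) (i : Fin N)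
    (x : RN N) (t : ℝ) :
    HasFDerivAt (fun x => duhD i g (x, t)) (formOf fun j => duhDD i j g (x, t)) x := by
  rcases le_or_gt t 0 with ht | ht
  · simp only [duhD, duhDD, duh, sqrt_two_mul_of_nonpos ht, avg, zero_mul, zero_smul, add_zero,
      integral_mul_const, integral_gaussD2, mul_zero, intervalIntegral.integral_zero]
    simpa [formOf] using hasFDerivAt_const (0:ℝ) x
  · have hK : ∀ i j : Fin N, 0 ≤ ∫ z : RN N, ‖z‖ ^ β * |gaussD2 i j z| := fun i j =>
      integral_nonneg fun z => by positivity
    refine hasFDerivAt_duh (c := fun R _ => R) (c' := fun _ θ => θ⁻¹) (integrable_gaussD1 i)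
      (integrable_gaussD2 i) (hasFDerivAt_gaussD1 i) hg hM (fun R => by fun_prop)
      (fun R => by fun_prop) (fun R hR θ hθ => by field_simp) ht
      (b := fun θ => (C * (∑ j, ∫ z : RN N, ‖z‖ ^ β * |gaussD2 i j z|) * √(2 * t) ^ β)
        * θ ^ (β - 1)) (intervalIntegrable_rpow_sub_one hβ.1 _) (fun j x θ hθ => ?_) x
    refine (duhDD_integrand_le hβ hg hM hC hC0 i j (q := (x, t)) le_rfl hθ).trans ?_
    have := hθ.1
    gcongr
    exact Finset.single_le_sum (f := fun j => ∫ z : RN N, ‖z‖ ^ β * |gaussD2 i j z|)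
      (fun j _ => hK i j) (Finset.mem_univ j)

/-- First derivatives of Duhamel's integral of a bounded function are Hölder continuous. -/
lemma exists_holder_duhD {N : ℕ} {g : RN N × ℝ → ℝ} {M β : ℝ} (hβ : β ∈ Ioo (0:ℝ) 1)
    (hg : Continuous g) (hM : ∀ q, |g q| ≤ M) (i : Fin N) (A : ℝ) :
    ∃ C, ∀ x y, ∀ t ≤ A, |duhD i g (x, t) - duhD i g (y, t)| ≤ C * ‖x - y‖ ^ β := by
  have hM0 : 0 ≤ M := (abs_nonneg _).trans (hM 0)
  set K1 := ∫ z : RN N, |gaussD1 i z| with hK1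
  set K2 := ∑ j, ∫ z : RN N, |gaussD2 i j z| with hK2
  have hK1' : 0 ≤ K1 := integral_nonneg fun z => abs_nonneg _
  have hK2' : 0 ≤ K2 := Finset.sum_nonneg fun j _ => integral_nonneg fun z => abs_nonneg _
  set L := 2 * (K1 * M) + N * (K2 * M) with hL
  have havg : ∀ (h : RN N → ℝ), Continuous h → (∀ x, |h x| ≤ M) → ∀ ρ > 0, ∀ x y,
      |avg (gaussD1 i) h ρ x - avg (gaussD1 i) h ρ y| ≤ L * (‖x - y‖ / ρ) ^ β := by
    intro h hh hhM ρ hρ x y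
    refine holder_interpolate hβ (by positivity) ?_ (by positivity) ?_
    · refine (abs_sub _ _).trans ?_
      rw [two_mul]
      exact add_le_add (abs_avg_le (integrable_gaussD1 i) hhM _ _)
        (abs_avg_le (integrable_gaussD1 i) hhM _ _)
    · have := lipschitz_of_form (B := ρ⁻¹ * (K2 * M)) (hasFDerivAt_avg (integrable_gaussD1 i)
        (integrable_gaussD2 i) (hasFDerivAt_gaussD1 i) hh hhM hρ.ne') (fun j x => ?_) x y
      · refine this.trans (le_of_eq ?_)
        field_simp
      · rw [abs_mul, abs_of_pos (inv_pos.2 hρ)]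
        refine mul_le_mul_of_nonneg_left ((abs_avg_le (integrable_gaussD2 i j) hhM _ _).trans ?_)
          (inv_nonneg.2 hρ.le)
        refine mul_le_mul_of_nonneg_right ?_ hM0
        exact Finset.single_le_sum (f := fun j => ∫ z : RN N, |gaussD2 i j z|)
          (fun j _ => integral_nonneg fun z => abs_nonneg _) (Finset.mem_univ j)
  have hL0 : 0 ≤ L := by positivity
  have hinteg : IntervalIntegrable (fun θ : ℝ => θ ^ (-β)) volume 0 1 :=
    intervalIntegral.intervalIntegrable_rpow' (by linarith [hβ.2])
  have hI0 : 0 ≤ ∫ θ in (0:ℝ)..1, θ ^ (-β) :=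
    intervalIntegral.integral_nonneg zero_le_one fun θ hθ => Real.rpow_nonneg hθ.1 _
  refine ⟨L * √(2 * A) ^ (1 - β) * ∫ θ in (0:ℝ)..1, θ ^ (-β), fun x y t ht => ?_⟩
  rcases le_or_gt t 0 with ht0 | ht0
  · simp only [duhD, duh, sqrt_two_mul_of_nonpos ht0]
    simp only [zero_mul, intervalIntegral.integral_zero, sub_self, abs_zero]
    positivity
  set R := √(2 * t) with hRdef
  have hR : 0 < R := by positivity
  have hcont : ∀ x, Continuous fun θ : ℝ =>
      R * avg (gaussD1 i) (fun y => g (y, t * (1 - θ ^ 2))) (R * θ) x := fun x =>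
    continuous_const.mul ((continuous_duh_integrand (integrable_gaussD1 i) hg hM).comp
      (Continuous.prodMk_right (x, t)))
  have hbd : |duhD i g (x, t) - duhD i g (y, t)|
      ≤ ∫ θ in (0:ℝ)..1, (L * R ^ (1 - β) * ‖x - y‖ ^ β) * θ ^ (-β) := by
    simp only [duhD, duh]
    rw [← intervalIntegral.integral_sub ((hcont x).intervalIntegrable _ _)
      ((hcont y).intervalIntegrable _ _), ← Real.norm_eq_abs]
    refine intervalIntegral.norm_integral_le_of_norm_le zero_le_one
      (Eventually.of_forall fun θ hθ => ?_) (hinteg.const_mul _)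
    rw [← mul_sub, norm_mul, Real.norm_of_nonneg hR.le, Real.norm_eq_abs]
    have h1 := havg (fun y => g (y, t * (1 - θ ^ 2))) (by fun_prop) (fun y => hM _) (R * θ)
      (mul_pos hR hθ.1) x y
    refine (mul_le_mul_of_nonneg_left h1 hR.le).trans (le_of_eq ?_)
    rw [Real.div_rpow (norm_nonneg _) (mul_pos hR hθ.1).le, Real.mul_rpow hR.le hθ.1.le,
      Real.rpow_neg hθ.1.le, Real.rpow_sub hR, Real.rpow_one]
    field_simp
  rw [intervalIntegral.integral_const_mul] at hbd
  refine hbd.trans ?_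
  have h1 : R ^ (1 - β) ≤ √(2 * A) ^ (1 - β) :=
    Real.rpow_le_rpow hR.le (by rw [hRdef]; gcongr) (by linarith [hβ.2])
  calc _ = (L * R ^ (1 - β) * ∫ θ in (0:ℝ)..1, θ ^ (-β)) * ‖x - y‖ ^ β := by ring
    _ ≤ _ := by gcongr

lemma exists_holder_duhW {N : ℕ} {g : RN N × ℝ → ℝ} {M β : ℝ} (hβ : β ∈ Ioo (0:ℝ) 1)
    (hg : Continuous g) (hM : ∀ q, |g q| ≤ M) (A : ℝ) :
    ∃ C, ∀ x y, ∀ t ≤ A, |duhW g (x, t) - duhW g (y, t)| ≤ C * ‖x - y‖ ^ β := by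
  have hM0 : 0 ≤ M := (abs_nonneg _).trans (hM 0)
  set K := ∑ i, ∫ z : RN N, |gaussD1 i z| with hK
  have hK0 : 0 ≤ K := Finset.sum_nonneg fun j _ => integral_nonneg fun z => abs_nonneg _
  refine ⟨2 * (√(2 * A) ^ 2 * M) + N * (√(2 * A) * (K * M)), fun x y t ht => ?_⟩
  refine holder_interpolate hβ (norm_nonneg _) ?_ (by positivity) ?_
  · refine (abs_sub _ _).trans ?_
    rw [two_mul]
    refine add_le_add ((abs_duhW_le hM _).trans ?_) ((abs_duhW_le hM _).trans ?_) <;>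
    · dsimp only
      gcongr
  · refine lipschitz_of_form (u := fun x => duhW g (x, t)) (fun x => hasFDerivAt_duhW hg hM x t)
      (fun i x => ?_) x y
    refine (abs_duhD_le i hM _).trans ?_
    dsimp only
    gcongr
    exact Finset.single_le_sum (f := fun i => ∫ z : RN N, |gaussD1 i z|)
      (fun i _ => integral_nonneg fun z => abs_nonneg _) (Finset.mem_univ i)

lemma avg_gaussL {N : ℕ} {g : RN N → ℝ} {M : ℝ} (hg : Continuous g) (hM : ∀ x, |g x| ≤ M)
    (ρ : ℝ) (x : RN N) : avg gaussL g ρ x = ∑ i, avg (gaussD2 i i) g ρ x := by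
  unfold avg
  simp_rw [gaussL, Finset.sum_mul]
  exact integral_finsetSum _ fun i _ =>
    integrable_mul_bounded (integrable_gaussD2 i i) (by fun_prop) fun z => hM _

lemma intervalIntegrable_duhDD {N : ℕ} {g : RN N × ℝ → ℝ} {M C β : ℝ} (hβ : β ∈ Ioo (0:ℝ) 1)
    (hg : Continuous g) (hM : ∀ q, |g q| ≤ M)
    (hC : ∀ x y t, |g (x, t) - g (y, t)| ≤ C * ‖x - y‖ ^ β) (hC0 : 0 ≤ C) (i j : Fin N)
    (q : RN N × ℝ) :
    IntervalIntegrable (fun θ => θ⁻¹ *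
      avg (gaussD2 i j) (fun y => g (y, q.2 * (1 - θ ^ 2))) (√(2 * q.2) * θ) q.1) volume 0 1 := by
  refine (intervalIntegrable_rpow_sub_one hβ.1
    (C * (∫ z : RN N, ‖z‖ ^ β * |gaussD2 i j z|) * √(2 * q.2) ^ β)).mono_fun' ?_ ?_
  · exact (measurable_inv.mul ((continuous_duh_integrand (integrable_gaussD2 i j) hg hM).comp
      (Continuous.prodMk continuous_const continuous_id)).measurable).aestronglyMeasurable
  · rw [uIoc_of_le zero_le_one]
    exact (ae_restrict_mem measurableSet_Ioc).mono fun θ hθ =>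
      duhDD_integrand_le hβ hg hM hC hC0 i j le_rfl hθ

lemma avg_gaussL_le {N : ℕ} {g : RN N → ℝ} {M C β : ℝ} (hβ : β ∈ Ioo (0:ℝ) 1)
    (hg : Continuous g) (hM : ∀ x, |g x| ≤ M) (hC : ∀ x y, |g x - g y| ≤ C * ‖x - y‖ ^ β)
    {ρ : ℝ} (hρ : 0 ≤ ρ) (x : RN N) :
    |avg gaussL g ρ x| ≤ (∑ i, C * (∫ z : RN N, ‖z‖ ^ β * |gaussD2 i i z|)) * ρ ^ β := by
  rw [avg_gaussL hg hM, Finset.sum_mul]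
  exact (Finset.abs_sum_le_sum_abs _ _).trans
    (Finset.sum_le_sum fun i _ => abs_avg_gaussD2_le hβ hg hM hC i i hρ x)

lemma avg_gaussD_zero {N : ℕ} (g : RN N → ℝ) (x : RN N) : avg gaussD g 0 x = g x := by
  simp [avg, integral_mul_const, integral_gaussD]

lemma duhW_time {N : ℕ} {g : RN N × ℝ → ℝ} {M C β : ℝ} (hβ : β ∈ Ioo (0:ℝ) 1)
    (hg : Continuous g) (hM : ∀ q, |g q| ≤ M)
    (hC : ∀ x y t, |g (x, t) - g (y, t)| ≤ C * ‖x - y‖ ^ β) (hC0 : 0 ≤ C)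
    (x : RN N) {t : ℝ} (ht : 0 ≤ t) :
    duhW g (x, t) = ∫ s in (0:ℝ)..t, (g (x, s) + ∑ i, duhDD i i g (x, s)) := by
  have hgr : ∀ r, Continuous fun y => g (y, r) := fun r => by fun_prop
  have key := duhamel_time_integral (β := β)
    (C := ∑ i, C * (∫ z : RN N, ‖z‖ ^ β * |gaussD2 i i z|))
    (c := fun ρ r => avg gaussD (fun y => g (y, r)) ρ x)
    (e := fun ρ r => avg gaussL (fun y => g (y, r)) ρ x) hβ.1
    (continuous_avg integrable_gaussD hg hM continuous_fst continuous_snd continuous_const)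
    (continuous_avg integrable_gaussL hg hM continuous_fst continuous_snd continuous_const)
    (fun ρ hρ r => hasDerivAt_avg_scale (hgr r) (fun y => hM _) hρ x)
    (fun ρ hρ r => avg_gaussL_le hβ (hgr r) (fun y => hM _) (fun y z => hC y z r) hρ.le x) ht
  have hs : √(2 * t) ^ 2 = 2 * t := Real.sq_sqrt (by linarith)
  calc duhW g (x, t) = _ := by simp only [duhW, duh, hs]
    _ = _ := key
    _ = _ := by
      congr 1; funext s
      rw [avg_gaussD_zero]
      congr 1
      simp only [duhDD, duh]
      rw [← intervalIntegral.integral_finsetSum fun i _ =>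
        intervalIntegrable_duhDD hβ hg hM hC hC0 i i (x, s)]
      congr 1; funext θ
      rw [avg_gaussL (hgr _) (fun y => hM _), Finset.mul_sum]

/-- `w₀` is of class `C²` with first derivatives `d₁` and second derivatives `d₂`, all bounded
by `M`. -/
structure C2Data {N : ℕ} (w₀ : RN N → ℝ) (d₁ : Fin N → RN N → ℝ)
    (d₂ : Fin N → Fin N → RN N → ℝ) (M : ℝ) : Prop where
  cont : Continuous w₀
  cont₁ : ∀ i, Continuous (d₁ i)
  cont₂ : ∀ i j, Continuous (d₂ i j)
  bound : ∀ x, |w₀ x| ≤ M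
  bound₁ : ∀ i x, |d₁ i x| ≤ M
  bound₂ : ∀ i j x, |d₂ i j x| ≤ M
  deriv₁ : ∀ x, HasFDerivAt w₀ (formOf fun i => d₁ i x) x
  deriv₂ : ∀ i x, HasFDerivAt (d₁ i) (formOf fun j => d₂ i j x) x

/-- A bounded function with bounded derivatives is Hölder continuous. -/
lemma exists_holder_of_form {N : ℕ} {u : RN N → ℝ} {a : Fin N → RN N → ℝ} {A B β : ℝ}
    (hβ : β ∈ Ioo (0:ℝ) 1) (hA : ∀ x, |u x| ≤ A) (hB0 : 0 ≤ B)
    (hd : ∀ x, HasFDerivAt u (formOf fun i => a i x) x) (ha : ∀ i x, |a i x| ≤ B) (x y : RN N) :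
    |u x - u y| ≤ (2 * A + N * B) * ‖x - y‖ ^ β :=
  holder_interpolate hβ (norm_nonneg _)
    ((abs_sub _ _).trans (by linarith [hA x, hA y])) (by positivity) (lipschitz_of_form hd ha x y)

lemma heat_time {N : ℕ} {w₀ : RN N → ℝ} {d₁ : Fin N → RN N → ℝ}
    {d₂ : Fin N → Fin N → RN N → ℝ} {M : ℝ} (h : C2Data w₀ d₁ d₂ M) (x : RN N) {t : ℝ}
    (ht : 0 ≤ t) : avg gaussD w₀ √(2 * t) x
      = w₀ x + ∫ s in (0:ℝ)..t, ∑ i, avg gaussD (d₂ i i) √(2 * s) x := by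
  have hβ : (1/2 : ℝ) ∈ Ioo (0:ℝ) 1 := by norm_num
  have hM0 : 0 ≤ M := (abs_nonneg _).trans (h.bound x)
  have key := sqrt_scale_eq (β := 1/2) (c := fun ρ => avg gaussD w₀ ρ x)
    (e := fun ρ => avg gaussL w₀ ρ x) hβ.1
    (continuous_avg' integrable_gaussD h.cont h.bound continuous_id continuous_const)
    (continuous_avg' integrable_gaussL h.cont h.bound continuous_id continuous_const).continuousOn
    (fun ρ hρ => hasDerivAt_avg_scale h.cont h.bound hρ x)
    (fun ρ hρ => avg_gaussL_le hβ h.cont h.bound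
      (exists_holder_of_form hβ h.bound hM0 h.deriv₁ h.bound₁) hρ.le x) ht
  rw [avg_gaussD_zero] at key
  rw [eq_add_of_sub_eq key.symm, add_comm]
  congr 1
  refine intervalIntegral_congr_Ioc ht fun s hs => ?_
  have hr : 0 < √(2 * s) := Real.sqrt_pos.2 (by linarith [hs.1])
  rw [avg_gaussL h.cont h.bound, Finset.mul_sum]
  refine Finset.sum_congr rfl fun i _ => ?_
  rw [avg_deriv_eq (integrable_gaussD1 i) (fun j => integrable_gaussD2 i j) (hasFDerivAt_gaussD1 i)
    h.cont h.bound h.cont₁ h.bound₁ h.deriv₁ hr.ne' x i,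
    avg_deriv_eq integrable_gaussD integrable_gaussD1 hasFDerivAt_gaussD
    (h.cont₁ i) (h.bound₁ i) (h.cont₂ i) (h.bound₂ i) (h.deriv₂ i) hr.ne' x i]
  have hs2 : √(2 * s) * √(2 * s) = 2 * s := Real.mul_self_sqrt (by linarith [hs.1])
  have : s ≠ 0 := hs.1.ne'
  rw [← mul_assoc (√(2 * s)), hs2]
  field_simp

/-- The solution of the heat equation with initial datum `w`. -/
def heat0 {N : ℕ} (w : RN N → ℝ) (q : RN N × ℝ) : ℝ := avg gaussD w √(2 * q.2) q.1

lemma continuous_heat0 {N : ℕ} {w : RN N → ℝ} {M : ℝ} (hw : Continuous w)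
    (hM : ∀ x, |w x| ≤ M) : Continuous (heat0 w) :=
  continuous_avg' integrable_gaussD hw hM (by fun_prop) continuous_fst

lemma hasFDerivAt_heat0 {N : ℕ} {g : RN N → ℝ}
    {g' : Fin N → RN N → ℝ} {M : ℝ} (hg : Continuous g) (hM : ∀ x, |g x| ≤ M)
    (hg' : ∀ i, Continuous (g' i)) (hM' : ∀ i x, |g' i x| ≤ M)
    (hd : ∀ x, HasFDerivAt g (formOf fun i => g' i x) x) (x : RN N) (t : ℝ) :
    HasFDerivAt (fun x => heat0 g (x, t)) (formOf fun i => heat0 (g' i) (x, t)) x :=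
  hasFDerivAt_avg_of_deriv integrable_gaussD hg hM hg' hM' hd √(2 * t) x

lemma abs_integral_gaussD {N : ℕ} : ∫ z : RN N, |gaussD z| = 1 := by
  simp_rw [abs_of_nonneg (gaussD_nonneg _)]; exact integral_gaussD

lemma abs_heat0_le {N : ℕ} {g : RN N → ℝ} {M : ℝ} (hM : ∀ x, |g x| ≤ M) (q : RN N × ℝ) :
    |heat0 g q| ≤ M := by
  have := abs_avg_le integrable_gaussD hM √(2 * q.2) q.1
  rwa [abs_integral_gaussD, one_mul] at this

lemma heat0_shift {N : ℕ} (w : RN N → ℝ) (a : RN N) (q : RN N × ℝ) :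
    heat0 w (q.1 + a, q.2) = heat0 (fun y => w (y + a)) q := by
  simp only [heat0, avg]; congr 1; funext z; congr 2; abel

lemma heat0_holder {N : ℕ} {w : RN N → ℝ} {M C β : ℝ} (hw : Continuous w)
    (hM : ∀ x, |w x| ≤ M) (hC : ∀ x y, |w x - w y| ≤ C * ‖x - y‖ ^ β) (x y : RN N) (t : ℝ) :
    |heat0 w (x, t) - heat0 w (y, t)| ≤ C * ‖x - y‖ ^ β := by
  have hi : ∀ x : RN N, Integrable fun z => gaussD z * w (x + √(2 * t) • z) := fun x =>
    integrable_mul_bounded integrable_gaussD (by fun_prop) fun z => hM _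
  have : heat0 w (x, t) - heat0 w (y, t)
      = ∫ z : RN N, gaussD z * (w (x + √(2 * t) • z) - w (y + √(2 * t) • z)) := by
    simp only [heat0, avg]
    rw [← integral_sub (hi x) (hi y)]; congr 1; funext z; ring
  rw [this]
  refine (abs_integral_mul_le integrable_gaussD (M := C * ‖x - y‖ ^ β) fun z => ?_).trans ?_
  · simpa using hC (x + √(2 * t) • z) (y + √(2 * t) • z)
  · rw [abs_integral_gaussD, one_mul]

lemma inhomogeneous_heat_time {N : ℕ} {w₀ : RN N → ℝ} {d₁ : Fin N → RN N → ℝ}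
    {d₂ : Fin N → Fin N → RN N → ℝ} {M : ℝ} (h : C2Data w₀ d₁ d₂ M)
    {g : RN N × ℝ → ℝ} {M' C β : ℝ} (hβ : β ∈ Ioo (0:ℝ) 1)
    (hg : Continuous g) (hM : ∀ q, |g q| ≤ M')
    (hC : ∀ x y t, |g (x, t) - g (y, t)| ≤ C * ‖x - y‖ ^ β) (hC0 : 0 ≤ C)
    (x : RN N) {t : ℝ} (ht : 0 ≤ t) :
    heat0 w₀ (x, t) + duhW g (x, t) = w₀ x + ∫ s in (0:ℝ)..t,
      (∑ i, (heat0 (d₂ i i) (x, s) + duhDD i i g (x, s)) + g (x, s)) := by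
  have e1 := heat_time h x ht
  have e2 := duhW_time hβ hg hM hC hC0 x ht
  have c1 : Continuous fun s => ∑ i, avg gaussD (d₂ i i) √(2 * s) x :=
    continuous_finsetSum _ fun i _ =>
      (continuous_heat0 (h.cont₂ i i) (h.bound₂ i i)).comp (Continuous.prodMk continuous_const continuous_id)
  have c2 : Continuous fun s => g (x, s) + ∑ i, duhDD i i g (x, s) := by
    have := fun i => continuous_duhDD hβ hg hM hC hC0 i i
    fun_prop
  rw [show heat0 w₀ (x, t) = _ from e1, e2, add_assoc,
    ← intervalIntegral.integral_add (c1.intervalIntegrable _ _) (c2.intervalIntegrable _ _)]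
  congr 2; funext s
  simp only [Finset.sum_add_distrib, heat0]; ring

/-- Properties of Duhamel's integral and of its first derivatives used in the fixed point
argument. -/
structure IsDuhOp {N : ℕ} (K : ℝ) (D : (RN N × ℝ → ℝ) → RN N × ℝ → ℝ) : Prop where
  cont : ∀ g M, Continuous g → (∀ q, |g q| ≤ M) → Continuous (D g)
  bound : ∀ g M, (∀ q, |g q| ≤ M) → ∀ q : RN N × ℝ, q.2 ≤ 1 → |D g q| ≤ √(2 * q.2) * (K * M)
  sub : ∀ g g' M, Continuous g → (∀ q, |g q| ≤ M) → Continuous g' → (∀ q, |g' q| ≤ M) →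
    ∀ q, D g q - D g' q = D (fun p => g p - g' p) q
  shift : ∀ g (a : RN N) (q : RN N × ℝ), D g (q.1 + a, q.2) = D (fun p => g (p.1 + a, p.2)) q

lemma isDuhOp_duhW {N : ℕ} {K : ℝ} (hK : 2 ≤ K) : IsDuhOp (N := N) K duhW where
  cont g M hg hM := continuous_duhW hg hM
  bound g M hM q hq := by
    have hM0 : 0 ≤ M := (abs_nonneg _).trans (hM 0)
    refine (abs_duhW_le hM q).trans ?_
    rw [pow_two, mul_assoc]
    have : √(2 * q.2) ≤ 2 := by
      rw [Real.sqrt_le_left (by norm_num)]; linarith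
    gcongr
    exact this.trans hK
  sub g g' M hg hM hg' hM' q := duh_sub integrable_gaussD hg hM hg' hM' (by fun_prop) q
  shift g a q := duh_shift _ _ g a q

lemma isDuhOp_duhD {N : ℕ} {K : ℝ} {i : Fin N} (hK : ∫ z, |gaussD1 i z| ≤ K) :
    IsDuhOp (N := N) K (duhD i) where
  cont g M hg hM := continuous_duhD hg hM i
  bound g M hM q hq := by
    have hM0 : 0 ≤ M := (abs_nonneg _).trans (hM 0)
    refine (abs_duhD_le i hM q).trans ?_
    gcongr
  sub g g' M hg hM hg' hM' q := duh_sub (integrable_gaussD1 i) hg hM hg' hM' (by fun_prop) q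
  shift g a q := duh_shift _ _ g a q

/-- Projection of `ℝ^N × ℝ` onto `ℝ^N × [0,T]`. -/
def timeProj {N : ℕ} (T : ℝ) (q : RN N × ℝ) : RN N × ℝ := (q.1, max 0 (min q.2 T))

/-- The nonlinear source terms of a system some equations of which run backward in time. -/
def sysSource {N : ℕ} {ι : Type*} (F : ι → RN N × (ι → ℝ) → ℝ) (s : ι → ι → Bool) (T : ℝ)
    (U : RN N × ℝ → ι → ℝ) (j : ι) (q : RN N × ℝ) : ℝ :=
  F j (q.1, fun k => U (q.1, if s j k then q.2 else T - q.2) k)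

lemma continuous_timeProj {N : ℕ} (T : ℝ) : Continuous (timeProj (N := N) T) := by
  unfold timeProj; fun_prop

lemma continuous_sysSource {N : ℕ} {ι : Type*} {F : ι → RN N × (ι → ℝ) → ℝ}
    (hF : ∀ j, Continuous (F j)) (s : ι → ι → Bool) (T : ℝ) {U : RN N × ℝ → ι → ℝ}
    (hU : Continuous U) (j : ι) : Continuous (sysSource F s T U j) := by
  unfold sysSource
  refine (hF j).comp (continuous_fst.prodMk (continuous_pi fun k => ?_))
  by_cases h : s j k = true
  · simp only [h, if_true]; fun_prop
  · simp only [h, Bool.false_eq_true, if_false]; fun_prop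

theorem exists_fixedPoint_system {N : ℕ} {ι : Type*} [Fintype ι] {K M L M₀ T : ℝ}
    (hK : 0 ≤ K) (hM : 0 ≤ M) (hL : 0 ≤ L) (hM₀ : 0 ≤ M₀) (hT0 : 0 ≤ T) (hT : T ≤ 1)
    (hTL : √(2 * T) * (K * L) ≤ 1 / 2)
    {D : ι → (RN N × ℝ → ℝ) → RN N × ℝ → ℝ} (hD : ∀ j, IsDuhOp K (D j))
    {I : ι → RN N × ℝ → ℝ} (hI : ∀ j, Continuous (I j)) (hIb : ∀ j q, |I j q| ≤ M₀)
    {F : ι → RN N × (ι → ℝ) → ℝ} (hF : ∀ j, Continuous (F j)) (hFM : ∀ j p, |F j p| ≤ M)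
    (hFL : ∀ j x v w, |F j (x, v) - F j (x, w)| ≤ L * ‖v - w‖) (s : ι → ι → Bool)
    {P : Set (RN N)} (hIP : ∀ j, ∀ a ∈ P, ∀ q, I j (q.1 + a, q.2) = I j q)
    (hFP : ∀ j, ∀ a ∈ P, ∀ p, F j (p.1 + a, p.2) = F j p) :
    ∃ U : RN N × ℝ → ι → ℝ, Continuous U ∧
      (∀ j q, U q j = I j (timeProj T q) + D j (sysSource F s T U j) (timeProj T q)) ∧
      ∀ a ∈ P, ∀ q, U (q.1 + a, q.2) = U q := by
  have htp : ∀ q : RN N × ℝ, (timeProj T q).2 ≤ T ∧ (timeProj T q).2 ≤ 1 := fun q => by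
    have : (timeProj T q).2 ≤ T := max_le hT0 (min_le_right _ _)
    exact ⟨this, this.trans hT⟩
  have hsb : ∀ U j q, |sysSource F s T U j q| ≤ M := fun U j q => hFM j _
  let Φ : (RN N × ℝ → ι → ℝ) → RN N × ℝ → ι → ℝ := fun U q j =>
    I j (timeProj T q) + D j (sysSource F s T U j) (timeProj T q)
  have hΦc : ∀ U, Continuous U → Continuous (Φ U) := fun U hU => continuous_pi fun j =>
    ((hI j).comp (continuous_timeProj T)).add
      (((hD j).cont _ M (continuous_sysSource hF s T hU j) (hsb U j)).comp (continuous_timeProj T))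
  have hΦb : ∀ U q, ‖Φ U q‖ ≤ M₀ + √(2 * T) * (K * M) := fun U q => by
    refine (pi_norm_le_iff_of_nonneg (by positivity)).2 fun j => (abs_add_le _ _).trans
      (add_le_add (hIb j _) (((hD j).bound _ M (hsb U j) _ (htp q).2).trans ?_))
    have := (htp q).1
    gcongr
  let Ψ : BoundedContinuousFunction (RN N × ℝ) (ι → ℝ) →
      BoundedContinuousFunction (RN N × ℝ) (ι → ℝ) := fun U =>
    BoundedContinuousFunction.ofNormedAddCommGroup (Φ U) (hΦc U U.continuous) _ (hΦb U)
  have hcon : ContractingWith (1 / 2) Ψ := by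
    refine ⟨by norm_num, LipschitzWith.of_dist_le_mul fun U V => ?_⟩
    refine (BoundedContinuousFunction.dist_le (by positivity)).2 fun q => ?_
    refine (dist_pi_le_iff (by positivity)).2 fun j => ?_
    have hdiff : ∀ p, |sysSource F s T U j p - sysSource F s T V j p| ≤ L * dist U V := fun p => by
      refine (hFL j _ _ _).trans ?_
      gcongr
      refine (pi_norm_le_iff_of_nonneg dist_nonneg).2 fun k => ?_
      exact (dist_le_pi_dist (U _) (V _) k).trans (BoundedContinuousFunction.dist_coe_le_dist _)
    have e : Ψ U q j - Ψ V q j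
        = D j (fun p => sysSource F s T U j p - sysSource F s T V j p) (timeProj T q) := by
      rw [← (hD j).sub _ _ M (continuous_sysSource hF s T U.continuous j) (hsb U j)
        (continuous_sysSource hF s T V.continuous j) (hsb V j)]
      change Φ U q j - Φ V q j = _
      simp only [Φ]; ring
    rw [Real.dist_eq, e]
    refine ((hD j).bound _ _ hdiff _ (htp q).2).trans ?_
    have := (htp q).1
    calc √(2 * (timeProj T q).2) * (K * (L * dist U V))
        ≤ √(2 * T) * (K * (L * dist U V)) := by gcongr
      _ = √(2 * T) * (K * L) * dist U V := by ring
      _ ≤ 1 / 2 * dist U V := by gcongr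
      _ = _ := by norm_num
  obtain ⟨U, hU⟩ : ∃ U, Ψ U = U := ⟨_, hcon.fixedPoint_isFixedPt⟩
  have hUq : ∀ j q, U q j = Φ U q j := fun j q =>
    congrFun (DFunLike.congr_fun hU.symm q) j
  refine ⟨U, U.continuous, hUq, fun a ha q => ?_⟩
  let V := U.compContinuous ⟨fun q : RN N × ℝ => (q.1 + a, q.2), by fun_prop⟩
  have hV : Ψ V = V := by
    ext q j
    change Φ V q j = U (q.1 + a, q.2) j
    rw [hUq]
    change I j (timeProj T q) + D j (sysSource F s T V j) (timeProj T q)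
      = I j ((timeProj T q).1 + a, (timeProj T q).2)
        + D j (sysSource F s T U j) ((timeProj T q).1 + a, (timeProj T q).2)
    rw [hIP j a ha, (hD j).shift]
    congr 2
    funext p
    exact (hFP j a ha (p.1, fun k => V (p.1, if s j k then p.2 else T - p.2) k)).symm
  have : V = U := (hcon.fixedPoint_unique hV).trans (hcon.fixedPoint_unique hU).symm
  exact DFunLike.congr_fun this q

/-- The lattice `ℤ^N` in `ℝ^N`. -/
def intLattice (N : ℕ) : Set (RN N) := range fun (z : Fin N → ℤ) i => (z i : ℝ)

lemma zPeriodic_iff {N : ℕ} {β : Type*} {u : RN N → β} :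
    ZPeriodic u ↔ ∀ a ∈ intLattice N, ∀ x, u (x + a) = u x := by
  constructor
  · rintro h _ ⟨z, rfl⟩ x
    exact h x z
  · exact fun h x z => h _ ⟨z, rfl⟩ x

lemma exists_add_mem_cube {N : ℕ} (x : RN N) : ∃ a ∈ intLattice N, x + a ∈ cube N := by
  refine ⟨_, ⟨fun i => -⌊x i⌋, rfl⟩, fun i => ?_, fun i => ?_⟩
  · have := Int.floor_le (x i)
    simpa using this
  · have := (Int.lt_floor_add_one (x i)).le
    simp only [Pi.add_apply, Int.cast_neg, Pi.one_apply]
    linarith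

lemma zPeriodic_pd {N : ℕ} {u : RN N → ℝ} (h : ZPeriodic u) (i : Fin N) : ZPeriodic (pd i u) := by
  rw [zPeriodic_iff] at h ⊢
  intro a ha x
  have : (fun y => u (y + a)) = u := funext fun y => h a ha y
  unfold pd
  rw [← fderiv_comp_add_right, this]

lemma isCompact_cube {N : ℕ} : IsCompact (cube N) := isCompact_Icc

lemma exists_bound_of_zPeriodic {N : ℕ} {u : RN N → ℝ} (hu : Continuous u) (h : ZPeriodic u) :
    ∃ M, ∀ x, |u x| ≤ M := by
  obtain ⟨M, hM⟩ := isCompact_cube.exists_bound_of_continuousOn (f := u) hu.continuousOn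
  refine ⟨M, fun x => ?_⟩
  obtain ⟨a, ha, hx⟩ := exists_add_mem_cube x
  rw [← zPeriodic_iff.1 h a ha x]
  exact hM _ hx

lemma exists_pos_le_of_zPeriodic {N : ℕ} {u : RN N → ℝ} (hu : Continuous u) (h : ZPeriodic u)
    (hpos : ∀ x, 0 < u x) : ∃ c > 0, ∀ x, c ≤ u x := by
  obtain ⟨x₀, -, hx₀⟩ := isCompact_cube.exists_isMinOn (f := u)
    ⟨0, by simp [cube]⟩ hu.continuousOn
  refine ⟨u x₀, hpos x₀, fun x => ?_⟩
  obtain ⟨a, ha, hx⟩ := exists_add_mem_cube x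
  rw [← zPeriodic_iff.1 h a ha x]
  exact hx₀ hx

/-- Componentwise projection onto a box. -/
def boxClamp {ι : Type*} (lo hi v : ι → ℝ) : ι → ℝ := fun k => max (lo k) (min (hi k) (v k))

lemma boxClamp_mem {ι : Type*} {lo hi : ι → ℝ} (h : lo ≤ hi) (v : ι → ℝ) :
    boxClamp lo hi v ∈ Icc lo hi :=
  ⟨fun _ => le_max_left _ _, fun k => max_le (h k) (min_le_left _ _)⟩

lemma boxClamp_of_mem {ι : Type*} {lo hi v : ι → ℝ} (h : v ∈ Icc lo hi) :
    boxClamp lo hi v = v := by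
  funext k
  simp only [boxClamp]
  rw [min_eq_right (h.2 k), max_eq_right (h.1 k)]

lemma norm_boxClamp_sub_le {ι : Type*} [Fintype ι] (lo hi v w : ι → ℝ) :
    ‖boxClamp lo hi v - boxClamp lo hi w‖ ≤ ‖v - w‖ := by
  refine (pi_norm_le_iff_of_nonneg (norm_nonneg _)).2 fun k => ?_
  have h1 := abs_max_sub_max_le_max (lo k) (min (hi k) (v k)) (lo k) (min (hi k) (w k))
  have h2 := abs_min_sub_min_le_max (hi k) (v k) (hi k) (w k)
  rw [sub_self, abs_zero, max_eq_right (a := 0) (abs_nonneg _)] at h1 h2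
  exact (h1.trans h2).trans (norm_le_pi_norm (v - w) k)

lemma continuous_boxClamp {ι : Type*} (lo hi : ι → ℝ) : Continuous (boxClamp lo hi) := by
  unfold boxClamp; fun_prop

theorem exists_bound_lipschitz_boxClamp {N : ℕ} {ι κ : Type*} [Fintype ι] [Fintype κ]
    {Ω : Set (ι → ℝ)} {F : RN N × (ι → ℝ) → κ → ℝ} (hF : ContDiffOn ℝ 1 F (univ ×ˢ Ω))
    (hper : ∀ v, ZPeriodic fun x => F (x, v)) {lo hi : ι → ℝ} (h : lo ≤ hi) (hΩ : Icc lo hi ⊆ Ω) :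
    (∀ e, Continuous fun p : RN N × (ι → ℝ) => F (p.1, boxClamp lo hi p.2) e) ∧
    ∃ M L : ℝ, 0 ≤ M ∧ 0 ≤ L ∧
      (∀ e (p : RN N × (ι → ℝ)), |F (p.1, boxClamp lo hi p.2) e| ≤ M) ∧
      ∀ e x v w, |F (x, boxClamp lo hi v) e - F (x, boxClamp lo hi w) e| ≤ L * ‖v - w‖ := by
  have hsub : cube N ×ˢ Icc lo hi ⊆ univ ×ˢ Ω := prod_mono (subset_univ _) hΩ
  have hK : IsCompact (cube N ×ˢ Icc lo hi) := isCompact_cube.prod isCompact_Icc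
  obtain ⟨M, hM⟩ := hK.exists_bound_of_continuousOn (hF.continuousOn.mono hsub)
  obtain ⟨L, hL⟩ := (hF.mono hsub).exists_lipschitzOnWith one_ne_zero
    ((convex_Icc _ _).prod (convex_Icc _ _)) hK
  refine ⟨fun e => ?_, max M 0, L, le_max_right _ _, L.2, fun e p => ?_, fun e x v w => ?_⟩
  · have : Continuous fun p : RN N × (ι → ℝ) => F (p.1, boxClamp lo hi p.2) :=
      hF.continuousOn.comp_continuous
        (continuous_fst.prodMk ((continuous_boxClamp lo hi).comp continuous_snd))
        fun p => ⟨mem_univ _, hΩ (boxClamp_mem h _)⟩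
    exact (continuous_apply e).comp this
  · obtain ⟨a, ha, hx⟩ := exists_add_mem_cube p.1
    rw [← zPeriodic_iff.1 (hper _) a ha p.1]
    exact (norm_le_pi_norm _ e).trans ((hM _ ⟨hx, boxClamp_mem h _⟩).trans (le_max_left _ _))
  · obtain ⟨a, ha, hx⟩ := exists_add_mem_cube x
    rw [← zPeriodic_iff.1 (hper _) a ha x, ← zPeriodic_iff.1 (hper _) a ha x]
    have := hL.dist_le_mul (x + a, boxClamp lo hi v) ⟨hx, boxClamp_mem h _⟩
      (x + a, boxClamp lo hi w) ⟨hx, boxClamp_mem h _⟩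
    refine (dist_le_pi_dist _ _ e).trans (this.trans ?_)
    gcongr
    rw [Prod.dist_eq, dist_self, max_eq_right dist_nonneg, dist_eq_norm]
    exact norm_boxClamp_sub_le lo hi v w

/-- Indices of the unknowns of the differentiated system: the first component is `none` for `m`
and `some i` for `∂_i u`, the second one is `none` for the function and `some j` for its `j`-th
space derivative. -/
abbrev MFGIndex (N : ℕ) := Option (Fin N) × Option (Fin N)

/-- The source terms of the differentiated mean field game system. -/
def mfgSource {N : ℕ} (H : RN N → ℝ) (f : RN N → ℝ → ℝ) (p : RN N × (MFGIndex N → ℝ)) :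
    Option (Fin N) → ℝ
  | none => ∑ k, (p.2 (none, some k) * pd k H (fun i => p.2 (some i, none)) +
      p.2 (none, none) * ∑ l, pd l (pd k H) (fun i => p.2 (some i, none)) * p.2 (some l, some k))
  | some i => -(∑ k, pd k H (fun i => p.2 (some i, none)) * p.2 (some k, some i)) -
      fderiv ℝ (fun q : RN N × ℝ => f q.1 q.2) (p.1, p.2 (none, none))
        (Pi.single i 1, p.2 (none, some i))

lemma contDiff_pd {N : ℕ} {m n : WithTop ℕ∞} {u : RN N → ℝ} (hu : ContDiff ℝ n u)
    (h : m + 1 ≤ n) (i : Fin N) : ContDiff ℝ m (pd i u) :=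
  (hu.fderiv_right h).clm_apply contDiff_const

/-- Values of the unknowns for which the density is positive. -/
def mfgDomain (N : ℕ) : Set (MFGIndex N → ℝ) := {v | 0 < v (none, none)}

lemma contDiffOn_mfgSource {N : ℕ} {H : RN N → ℝ} {f : RN N → ℝ → ℝ} (hH : ContDiff ℝ 3 H)
    (hf : ContDiffOn ℝ 3 (fun q : RN N × ℝ => f q.1 q.2)
      ((Set.univ : Set (RN N)) ×ˢ Ioi (0:ℝ))) :
    ContDiffOn ℝ 1 (mfgSource H f) (univ ×ˢ mfgDomain N) := by
  have hv : ∀ k, ContDiff ℝ 1 fun p : RN N × (MFGIndex N → ℝ) => p.2 k := fun k =>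
    (contDiff_apply ℝ ℝ k).comp contDiff_snd
  have hp : ContDiff ℝ 1 fun (p : RN N × (MFGIndex N → ℝ)) (i : Fin N) => p.2 (some i, none) :=
    contDiff_pi.2 fun i => hv _
  have h1 : ∀ k, ContDiff ℝ 1 fun p : RN N × (MFGIndex N → ℝ) =>
      pd k H (fun i => p.2 (some i, none)) := fun k =>
    (contDiff_pd (m := 1) hH (by norm_num) k).comp hp
  have h2 : ∀ k l, ContDiff ℝ 1 fun p : RN N × (MFGIndex N → ℝ) =>
      pd l (pd k H) (fun i => p.2 (some i, none)) := fun k l =>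
    (contDiff_pd (m := 1) (contDiff_pd (m := 2) hH (by norm_num) k) (by norm_num) l).comp hp
  have hf1 := hf.fderiv_of_isOpen (m := 1) (isOpen_univ.prod isOpen_Ioi) (by norm_num)
  refine contDiffOn_pi.2 fun e => ?_
  match e with
  | none =>
    exact (ContDiff.sum fun k _ => ((hv _).mul (h1 k)).add
      ((hv _).mul (ContDiff.sum fun l _ => (h2 k l).mul (hv _)))).contDiffOn
  | some i =>
    refine ContDiffOn.sub
      (ContDiff.sum fun k _ => (h1 k).mul (hv _)).neg.contDiffOn (ContDiffOn.clm_apply ?_ ?_)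
    · exact hf1.comp (contDiff_fst.prodMk (hv _)).contDiffOn fun p hp => ⟨mem_univ _, hp.2⟩
    · exact (contDiff_const.prodMk (hv _)).contDiffOn

lemma fderiv_periodic {N : ℕ} {f : RN N → ℝ → ℝ} (hfper : ∀ s, ZPeriodic fun x => f x s)
    {a : RN N} (ha : a ∈ intLattice N) (x : RN N) (s : ℝ) :
    fderiv ℝ (fun q : RN N × ℝ => f q.1 q.2) (x + a, s)
      = fderiv ℝ (fun q : RN N × ℝ => f q.1 q.2) (x, s) := by
  have : (fun q : RN N × ℝ => (fun q : RN N × ℝ => f q.1 q.2) (q + (a, 0)))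
      = fun q : RN N × ℝ => f q.1 q.2 := by
    funext q
    simpa using zPeriodic_iff.1 (hfper q.2) a ha q.1
  rw [show (x + a, s) = (x, s) + (a, 0) by simp, ← fderiv_comp_add_right, this]

lemma zPeriodic_mfgSource {N : ℕ} {H : RN N → ℝ} {f : RN N → ℝ → ℝ}
    (hfper : ∀ s, ZPeriodic fun x => f x s) (v : MFGIndex N → ℝ) :
    ZPeriodic fun x => mfgSource H f (x, v) := by
  refine zPeriodic_iff.2 fun a ha x => funext fun e => ?_
  match e with
  | none => rfl
  | some i => simp only [mfgSource, fderiv_periodic hfper ha]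

/-- `w` is periodic in space and, on `ℝ^N × [0,T]`, continuous together with its time derivative
`W'`, its first space derivatives `W₁` and its second space derivatives `W₂`. -/
structure SpaceTimeC2 {N : ℕ} (T : ℝ) (w : RN N → ℝ → ℝ) (W' : RN N × ℝ → ℝ)
    (W₁ : Fin N → RN N × ℝ → ℝ) (W₂ : Fin N → Fin N → RN N × ℝ → ℝ) : Prop where
  per : ∀ t, ZPeriodic fun x => w x t
  cont : ContinuousOn (fun q : RN N × ℝ => w q.1 q.2) (univ ×ˢ Icc 0 T)
  contT : ContinuousOn W' (univ ×ˢ Icc 0 T)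
  cont₁ : ∀ i, ContinuousOn (W₁ i) (univ ×ˢ Icc 0 T)
  cont₂ : ∀ i j, ContinuousOn (W₂ i j) (univ ×ˢ Icc 0 T)
  derivT : ∀ x, ∀ t ∈ Icc 0 T, HasDerivAt (w x) (W' (x, t)) t
  deriv₁ : ∀ t ∈ Icc 0 T, ∀ x, HasFDerivAt (fun y => w y t) (formOf fun i => W₁ i (x, t)) x
  deriv₂ : ∀ i, ∀ t ∈ Icc 0 T, ∀ x,
    HasFDerivAt (fun y => W₁ i (y, t)) (formOf fun j => W₂ i j (x, t)) x

namespace SpaceTimeC2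

variable {N : ℕ} {T : ℝ} {w : RN N → ℝ → ℝ} {W' : RN N × ℝ → ℝ} {W₁ : Fin N → RN N × ℝ → ℝ}
  {W₂ : Fin N → Fin N → RN N × ℝ → ℝ}

lemma pd_eq (h : SpaceTimeC2 T w W' W₁ W₂) (i : Fin N) {t : ℝ} (ht : t ∈ Icc 0 T) :
    (pd i fun y => w y t) = fun x => W₁ i (x, t) :=
  funext fun x => pd_eq_of_hasFDerivAt (h.deriv₁ t ht x) i

lemma pd_pd_eq (h : SpaceTimeC2 T w W' W₁ W₂) (i j : Fin N) {t : ℝ} (ht : t ∈ Icc 0 T) (x : RN N) :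
    pd i (pd j fun y => w y t) x = W₂ j i (x, t) := by
  rw [h.pd_eq j ht]
  exact pd_eq_of_hasFDerivAt (h.deriv₂ j t ht x) i

lemma reverse (h : SpaceTimeC2 T w W' W₁ W₂) :
    SpaceTimeC2 T (fun x t => w x (T - t)) (fun q => -W' (q.1, T - q.2))
      (fun i q => W₁ i (q.1, T - q.2)) (fun i j q => W₂ i j (q.1, T - q.2)) := by
  have hm : ∀ t ∈ Icc 0 T, T - t ∈ Icc 0 T := fun t ht => ⟨by linarith [ht.2], by linarith [ht.1]⟩
  have hc : ∀ g : RN N × ℝ → ℝ, ContinuousOn g (univ ×ˢ Icc 0 T) →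
      ContinuousOn (fun q : RN N × ℝ => g (q.1, T - q.2)) (univ ×ˢ Icc 0 T) := fun g hg =>
    hg.comp (by fun_prop) fun q hq => ⟨mem_univ _, hm _ hq.2⟩
  exact
  { per := fun t => h.per (T - t)
    cont := hc _ h.cont
    contT := (hc _ h.contT).neg
    cont₁ := fun i => hc _ (h.cont₁ i)
    cont₂ := fun i j => hc _ (h.cont₂ i j)
    derivT := fun x t ht => by
      simpa using (h.derivT x _ (hm t ht)).comp_const_sub T t
    deriv₁ := fun t ht => h.deriv₁ _ (hm t ht)
    deriv₂ := fun i t ht => h.deriv₂ i _ (hm t ht) }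

end SpaceTimeC2

theorem exists_heat_solution {N : ℕ} {w₀ : RN N → ℝ} {d₁ : Fin N → RN N → ℝ}
    {d₂ : Fin N → Fin N → RN N → ℝ} {M : ℝ} (h : C2Data w₀ d₁ d₂ M)
    {g : RN N × ℝ → ℝ} {M' C β : ℝ} (hβ : β ∈ Ioo (0:ℝ) 1)
    (hg : Continuous g) (hM : ∀ q, |g q| ≤ M')
    (hC : ∀ x y t, |g (x, t) - g (y, t)| ≤ C * ‖x - y‖ ^ β) (hC0 : 0 ≤ C)
    (hw₀p : ZPeriodic w₀) (hd₂p : ∀ i, ZPeriodic (d₂ i i))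
    (hgp : ∀ t, ZPeriodic fun x => g (x, t)) (T : ℝ) :
    ∃ (w : RN N → ℝ → ℝ) (W₂ : Fin N → Fin N → RN N × ℝ → ℝ),
      (∀ x, ∀ t ∈ Icc 0 T, w x t = heat0 w₀ (x, t) + duhW g (x, t)) ∧ (∀ x, w x 0 = w₀ x) ∧
      SpaceTimeC2 T w (fun q => ∑ i, W₂ i i q + g q) (fun i q => heat0 (d₁ i) q + duhD i g q) W₂ := by
  set W₂ : Fin N → Fin N → RN N × ℝ → ℝ := fun i j q => heat0 (d₂ i j) q + duhDD i j g q with hW₂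
  set φ : RN N × ℝ → ℝ := fun q => ∑ i, W₂ i i q + g q with hφ
  have cW₂ : ∀ i j, Continuous (W₂ i j) := fun i j =>
    (continuous_heat0 (h.cont₂ i j) (h.bound₂ i j)).add (continuous_duhDD hβ hg hM hC hC0 i j)
  have cφ : Continuous φ := by fun_prop
  have cφt : ∀ x, Continuous fun s => φ (timeProj T (x, s)) := fun x =>
    cφ.comp ((continuous_timeProj T).comp (by fun_prop))
  have htp : ∀ (x : RN N), ∀ t ∈ Icc 0 T, timeProj T (x, t) = (x, t) := fun x t ht => by
    simp [timeProj, min_eq_left ht.2, max_eq_right ht.1]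
  set w : RN N → ℝ → ℝ := fun x t => w₀ x + ∫ s in (0:ℝ)..t, φ (timeProj T (x, s)) with hw
  have hwe : ∀ x, ∀ t ∈ Icc 0 T, w x t = heat0 w₀ (x, t) + duhW g (x, t) := fun x t ht => by
    rw [inhomogeneous_heat_time h hβ hg hM hC hC0 x ht.1]
    simp only [hw]
    congr 1
    refine intervalIntegral_congr_Ioc ht.1 fun s hs => ?_
    rw [htp x s ⟨hs.1.le, hs.2.trans ht.2⟩]
  have hwt : ∀ t ∈ Icc 0 T, (fun y => w y t) = fun y => heat0 w₀ (y, t) + duhW g (y, t) :=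
    fun t ht => funext fun y => hwe y t ht
  have hgs : ∀ a ∈ intLattice N, (fun p : RN N × ℝ => g (p.1 + a, p.2)) = g := fun a ha =>
    funext fun p => zPeriodic_iff.1 (hgp p.2) a ha p.1
  have hφp : ∀ a ∈ intLattice N, ∀ q : RN N × ℝ, φ (q.1 + a, q.2) = φ q := fun a ha q => by
    have h2 : ∀ i, (fun y => d₂ i i (y + a)) = d₂ i i := fun i =>
      funext fun y => zPeriodic_iff.1 (hd₂p i) a ha y
    simp only [hφ, hW₂, duhDD, heat0_shift, duh_shift, hgs a ha, h2]
    rw [zPeriodic_iff.1 (hgp q.2) a ha q.1]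
  refine ⟨w, W₂, hwe, fun x => by simp [hw], ?_, ?_, cφ.continuousOn, fun i => ?_,
    fun i j => (cW₂ i j).continuousOn, fun x t ht => ?_, fun t ht x => ?_, fun i t ht x => ?_⟩
  · refine fun t => zPeriodic_iff.2 fun a ha x => ?_
    simp only [hw, zPeriodic_iff.1 hw₀p a ha x]
    congr 2; funext s
    exact hφp a ha (timeProj T (x, s))
  · exact ((continuous_heat0 h.cont h.bound).add (continuous_duhW hg hM)).continuousOn.congr
      fun q hq => hwe q.1 q.2 hq.2
  · exact ((continuous_heat0 (h.cont₁ i) (h.bound₁ i)).add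
      (continuous_duhD hg hM i)).continuousOn
  · have := ((cφt x).integral_hasStrictDerivAt 0 t).hasDerivAt.const_add (w₀ x)
    rwa [htp x t ht] at this
  · rw [hwt t ht]
    refine ((hasFDerivAt_heat0 h.cont h.bound h.cont₁ h.bound₁ h.deriv₁ x t).add
      (hasFDerivAt_duhW hg hM x t)).congr_fderiv (clm_ext_single fun i => ?_)
    simp only [_root_.add_apply, formOf_single]
  · refine ((hasFDerivAt_heat0 (h.cont₁ i) (h.bound₁ i) (h.cont₂ i) (h.bound₂ i) (h.deriv₂ i) x t).add
      (hasFDerivAt_duhD hβ hg hM hC hC0 i x t)).congr_fderiv (clm_ext_single fun j => ?_)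
    simp only [_root_.add_apply, formOf_single, hW₂]

lemma exists_c2Data {N : ℕ} {w : RN N → ℝ} (hw : ContDiff ℝ 2 w) (hp : ZPeriodic w) :
    ∃ M, C2Data w (fun i => pd i w) (fun i j => pd j (pd i w)) M := by
  have h1 : ∀ i, ContDiff ℝ 1 (pd i w) := fun i => contDiff_pd hw (by norm_num) i
  have h2 : ∀ i j, ContDiff ℝ 0 (pd j (pd i w)) := fun i j => contDiff_pd (h1 i) (by norm_num) j
  obtain ⟨A, hA⟩ := exists_bound_of_zPeriodic hw.continuous hp
  choose B hB using fun i => exists_bound_of_zPeriodic (h1 i).continuous (zPeriodic_pd hp i)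
  choose E hE using fun i j =>
    exists_bound_of_zPeriodic (h2 i j).continuous (zPeriodic_pd (zPeriodic_pd hp i) j)
  have hA0 := (abs_nonneg _).trans (hA 0)
  have hB0 : ∀ i, 0 ≤ B i := fun i => (abs_nonneg _).trans (hB i 0)
  have hE0 : ∀ i j, 0 ≤ E i j := fun i j => (abs_nonneg _).trans (hE i j 0)
  have sB : 0 ≤ ∑ i, B i := Finset.sum_nonneg fun i _ => hB0 i
  have sE' : ∀ i, 0 ≤ ∑ j, E i j := fun i => Finset.sum_nonneg fun j _ => hE0 i j
  have sE : 0 ≤ ∑ i, ∑ j, E i j := Finset.sum_nonneg fun i _ => sE' i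
  refine ⟨A + ∑ i, B i + ∑ i, ∑ j, E i j, hw.continuous, fun i => (h1 i).continuous,
    fun i j => (h2 i j).continuous, fun x => ?_, fun i x => ?_, fun i j x => ?_, fun x => ?_,
    fun i x => ?_⟩
  · linarith [hA x]
  · linarith [hB i x, Finset.single_le_sum (fun i _ => hB0 i) (Finset.mem_univ i)]
  · linarith [hE i j x, Finset.single_le_sum (fun i _ => sE' i) (Finset.mem_univ i),
      Finset.single_le_sum (fun j _ => hE0 i j) (Finset.mem_univ j)]
  · exact hasFDerivAt_formOf_pd (hw.differentiable (by norm_num) x)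
  · exact hasFDerivAt_formOf_pd ((h1 i).differentiable (by norm_num) x)

lemma le_heat0 {N : ℕ} {w : RN N → ℝ} {M c : ℝ} (hw : Continuous w) (hM : ∀ x, |w x| ≤ M)
    (hc : ∀ x, c ≤ w x) (q : RN N × ℝ) : c ≤ heat0 w q := by
  have h1 : ∫ z : RN N, gaussD z * c = c := by rw [integral_mul_const, integral_gaussD, one_mul]
  rw [← h1]
  exact integral_mono (integrable_gaussD.mul_const c)
    (integrable_mul_bounded integrable_gaussD (by fun_prop) fun z => hM _)
    fun z => mul_le_mul_of_nonneg_left (hc _) (gaussD_nonneg z)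

/-- Initial data of the differentiated mean field game system. -/
def mfgInit {N : ℕ} (m₀ uT : RN N → ℝ) : MFGIndex N → RN N → ℝ
  | (none, none) => m₀
  | (none, some j) => pd j m₀
  | (some i, none) => pd i uT
  | (some i, some j) => pd j (pd i uT)

/-- Duhamel's operator attached to an unknown. -/
def mfgDuh {N : ℕ} : MFGIndex N → (RN N × ℝ → ℝ) → RN N × ℝ → ℝ
  | (_, none) => duhW
  | (_, some j) => duhD j

/-- Values of the unknowns entering an equation which runs in its own time direction. -/
def mfgValues {N : ℕ} (T : ℝ) (e : Option (Fin N)) (U : RN N × ℝ → MFGIndex N → ℝ)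
    (q : RN N × ℝ) : MFGIndex N → ℝ :=
  fun k => U (q.1, if e.isSome == k.1.isSome then q.2 else T - q.2) k

/-- A mild solution `U` of the differentiated mean field game system, with sources `g`. -/
structure MFGMild {N : ℕ} (H : RN N → ℝ) (f : RN N → ℝ → ℝ) (m₀ uT : RN N → ℝ) (T β : ℝ)
    (lo hi : MFGIndex N → ℝ) (U : RN N × ℝ → MFGIndex N → ℝ)
    (g : Option (Fin N) → RN N × ℝ → ℝ) (M C : ℝ) : Prop where
  lo_le_hi : lo ≤ hi
  box : Icc lo hi ⊆ mfgDomain N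
  cont : Continuous U
  mem : ∀ q, U q ∈ Icc lo hi
  per : ∀ a ∈ intLattice N, ∀ q, U (q.1 + a, q.2) = U q
  source : ∀ e q, g e q = mfgSource H f (q.1, mfgValues T e U q) e
  cont_g : ∀ e, Continuous (g e)
  bound_g : ∀ e q, |g e q| ≤ M
  C_nonneg : 0 ≤ C
  holder_g : ∀ x y t, |g none (x, t) - g none (y, t)| ≤ C * ‖x - y‖ ^ β
  eq : ∀ j q, U q j = heat0 (mfgInit m₀ uT j) (timeProj T q) + mfgDuh j (g j.1) (timeProj T q)

lemma exists_holder_mfgDuh {N : ℕ} {g : RN N × ℝ → ℝ} {M β : ℝ} (hβ : β ∈ Ioo (0:ℝ) 1)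
    (hg : Continuous g) (hM : ∀ q, |g q| ≤ M) (A : ℝ) (j : MFGIndex N) :
    ∃ C, ∀ x y, ∀ t ≤ A, |mfgDuh j g (x, t) - mfgDuh j g (y, t)| ≤ C * ‖x - y‖ ^ β := by
  match j with
  | (_, none) => exact exists_holder_duhW hβ hg hM A
  | (_, some i) => exact exists_holder_duhD hβ hg hM i A

lemma mfgInit_props {N : ℕ} {m₀ uT : RN N → ℝ} {β : ℝ} (hβ : β ∈ Ioo (0:ℝ) 1)
    (hm₀reg : ContDiff ℝ 2 m₀) (hm₀per : ZPeriodic m₀)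
    (huTreg : ContDiff ℝ 2 uT) (huTper : ZPeriodic uT)
    (huThold : ∀ i j, ∃ C, ∀ x y,
      |pd i (pd j uT) x - pd i (pd j uT) y| ≤ C * ‖x - y‖ ^ β) :
    ∃ M₀, 0 ≤ M₀ ∧ ∀ j, Continuous (mfgInit m₀ uT j) ∧ (∀ x, |mfgInit m₀ uT j x| ≤ M₀) ∧
      ZPeriodic (mfgInit m₀ uT j) ∧
      ∃ C, ∀ x y, |mfgInit m₀ uT j x - mfgInit m₀ uT j y| ≤ C * ‖x - y‖ ^ β := by
  obtain ⟨A, hA⟩ := exists_c2Data hm₀reg hm₀per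
  obtain ⟨B, hB⟩ := exists_c2Data huTreg huTper
  have hA0 := (abs_nonneg _).trans (hA.bound 0)
  have hB0 := (abs_nonneg _).trans (hB.bound 0)
  refine ⟨max A B, le_max_of_le_left hA0, fun j => ?_⟩
  match j with
  | (none, none) =>
    exact ⟨hA.cont, fun x => (hA.bound x).trans (le_max_left _ _), hm₀per, _,
      exists_holder_of_form hβ hA.bound hA0 hA.deriv₁ hA.bound₁⟩
  | (none, some j) =>
    exact ⟨hA.cont₁ j, fun x => (hA.bound₁ j x).trans (le_max_left _ _), zPeriodic_pd hm₀per j, _,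
      exists_holder_of_form hβ (hA.bound₁ j) hA0 (hA.deriv₂ j) (hA.bound₂ j)⟩
  | (some i, none) =>
    exact ⟨hB.cont₁ i, fun x => (hB.bound₁ i x).trans (le_max_right _ _), zPeriodic_pd huTper i, _,
      exists_holder_of_form hβ (hB.bound₁ i) hB0 (hB.deriv₂ i) (hB.bound₂ i)⟩
  | (some i, some j) =>
    exact ⟨hB.cont₂ i j, fun x => (hB.bound₂ i j x).trans (le_max_right _ _),
      zPeriodic_pd (zPeriodic_pd huTper i) j, huThold j i⟩

set_option maxHeartbeats 2000000 in
theorem exists_mfgMild {N : ℕ} {β : ℝ} (hβ : β ∈ Ioo (0:ℝ) 1)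
    {H : RN N → ℝ} {f : RN N → ℝ → ℝ} {m₀ uT : RN N → ℝ} (hH : ContDiff ℝ 3 H)
    (hf : ContDiffOn ℝ 3 (fun q : RN N × ℝ => f q.1 q.2)
      ((Set.univ : Set (RN N)) ×ˢ Ioi (0:ℝ)))
    (hfper : ∀ s, ZPeriodic fun x => f x s)
    (hm₀reg : ContDiff ℝ 2 m₀) (hm₀per : ZPeriodic m₀)
    (huTreg : ContDiff ℝ 2 uT) (huTper : ZPeriodic uT)
    (huThold : ∀ i j, ∃ C, ∀ x y,
      |pd i (pd j uT) x - pd i (pd j uT) y| ≤ C * ‖x - y‖ ^ β)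
    (hm₀pos : ∀ x, 0 < m₀ x) :
    ∃ Tstar > (0:ℝ), ∀ T : ℝ, 0 < T → T ≤ Tstar →
      ∃ lo hi U g M C, MFGMild H f m₀ uT T β lo hi U g M C := by
  obtain ⟨M₀, hM₀, hinit⟩ := mfgInit_props hβ hm₀reg hm₀per huTreg huTper huThold
  obtain ⟨c, hc, hcm⟩ := exists_pos_le_of_zPeriodic hm₀reg.continuous hm₀per hm₀pos
  have hcM : c ≤ M₀ := (hcm 0).trans ((le_abs_self _).trans ((hinit (none, none)).2.1 0))
  set lo : MFGIndex N → ℝ := fun k => if k = (none, none) then c / 2 else -(M₀ + 1) with hlo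
  set hi : MFGIndex N → ℝ := fun _ => M₀ + 1 with hhi
  have hlohi : lo ≤ hi := fun k => by
    simp only [hlo, hhi]; split_ifs <;> linarith
  have hbox : Icc lo hi ⊆ mfgDomain N := fun v hv => by
    have := hv.1 (none, none)
    simp only [hlo, if_true] at this
    exact lt_of_lt_of_le (by linarith) this
  obtain ⟨hFc, M, L, hM, hL, hFM, hFL⟩ := exists_bound_lipschitz_boxClamp
    (contDiffOn_mfgSource hH hf) (zPeriodic_mfgSource hfper) hlohi hbox
  set K : ℝ := 2 + ∑ i : Fin N, ∫ z, |gaussD1 i z| with hK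
  have hK1 : ∀ i : Fin N, 0 ≤ ∫ z, |gaussD1 i z| := fun i => integral_nonneg fun z => abs_nonneg _
  have hK2 : 2 ≤ K := le_add_of_nonneg_right (Finset.sum_nonneg fun i _ => hK1 i)
  have hK0 : 0 ≤ K := by linarith
  have hD : ∀ j : MFGIndex N, IsDuhOp K (mfgDuh j) := fun j => by
    match j with
    | (_, none) => exact isDuhOp_duhW hK2
    | (_, some i) =>
      refine isDuhOp_duhD ?_
      linarith [Finset.single_le_sum (fun i _ => hK1 i) (Finset.mem_univ i)]
  set δ : ℝ := min (1 / 2) (c / 2) with hδ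
  have hδ0 : 0 < δ := lt_min (by norm_num) (by linarith)
  set r : ℝ := δ / (K * (L + M) + 1) with hr
  have hden : 0 < K * (L + M) + 1 := by positivity
  have hr0 : 0 < r := div_pos hδ0 hden
  refine ⟨min 1 (r ^ 2 / 2), by positivity, fun T hT0 hT => ?_⟩
  have hT1 : T ≤ 1 := hT.trans (min_le_left _ _)
  have hTr : √(2 * T) ≤ r := by
    rw [Real.sqrt_le_left hr0.le]
    linarith [hT.trans (min_le_right _ _)]
  have hrδ : r * (K * (L + M) + 1) = δ := div_mul_cancel₀ _ hden.ne'
  have hTL : √(2 * T) * (K * L) ≤ δ := by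
    rw [← hrδ]
    gcongr
    nlinarith [mul_nonneg hK0 hM]
  have hTM : √(2 * T) * (K * M) ≤ δ := by
    rw [← hrδ]
    gcongr
    nlinarith [mul_nonneg hK0 hL]
  obtain ⟨U, hUc, hUe, hUp⟩ := exists_fixedPoint_system (P := intLattice N) hK0 hM hL hM₀ hT0.le hT1
    (hTL.trans (min_le_left _ _)) hD (I := fun j => heat0 (mfgInit m₀ uT j))
    (fun j => continuous_heat0 (hinit j).1 (hinit j).2.1)
    (fun j => abs_heat0_le (hinit j).2.1)
    (F := fun j p => mfgSource H f (p.1, boxClamp lo hi p.2) j.1)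
    (fun j => hFc j.1) (fun j => hFM j.1) (fun j => hFL j.1)
    (fun j k => j.1.isSome == k.1.isSome)
    (fun j a ha q => by
      rw [heat0_shift]; congr 1; funext y; exact zPeriodic_iff.1 (hinit j).2.2.1 a ha y)
    (fun j a ha p => congrFun (zPeriodic_iff.1 (zPeriodic_mfgSource hfper _) a ha p.1) j.1)
  set g : Option (Fin N) → RN N × ℝ → ℝ := fun e q =>
    mfgSource H f (q.1, boxClamp lo hi (mfgValues T e U q)) e with hg
  have hUe' : ∀ j q, U q j = heat0 (mfgInit m₀ uT j) (timeProj T q)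
      + mfgDuh j (g j.1) (timeProj T q) := hUe
  have htp : ∀ q : RN N × ℝ, (timeProj T q).2 ≤ T := fun q => max_le hT0.le (min_le_right _ _)
  have hgM : ∀ e q, |g e q| ≤ M := fun e q => hFM e (q.1, mfgValues T e U q)
  have hDs : ∀ j q, |mfgDuh j (g j.1) (timeProj T q)| ≤ δ := fun j q => by
    refine ((hD j).bound _ M (hgM j.1) _ ((htp q).trans hT1)).trans (le_trans ?_ hTM)
    have := htp q
    gcongr
  have hmem : ∀ q, U q ∈ Icc lo hi := fun q => by
    have h1 := fun j => abs_le.1 (hDs j q)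
    have h2 := fun j => abs_le.1 (abs_heat0_le (hinit j).2.1 (timeProj T q))
    have hδ1 : δ ≤ 1 / 2 := min_le_left _ _
    have hδ2 : δ ≤ c / 2 := min_le_right _ _
    refine ⟨fun k => ?_, fun k => ?_⟩
    · rw [hUe']
      simp only [hlo]
      split_ifs with hk
      · subst hk
        have := le_heat0 (hinit (none, none)).1 (hinit (none, none)).2.1 hcm (timeProj T q)
        linarith [(h1 (none, none)).1]
      · linarith [(h1 k).1, (h2 k).1]
    · rw [hUe']
      simp only [hhi]
      linarith [(h1 k).2, (h2 k).2]
  have hgc : ∀ e, Continuous (g e) := fun e =>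
    continuous_sysSource (F := fun (j : MFGIndex N) p => mfgSource H f (p.1, boxClamp lo hi p.2) j.1)
      (fun j => hFc j.1) (fun j k => j.1.isSome == k.1.isSome) T hUc (e, none)
  choose C₁ hC₁ using fun j => (hinit j).2.2.2
  choose C₂ hC₂ using fun j : MFGIndex N => exists_holder_mfgDuh hβ (hgc j.1) (hgM j.1) T j
  have hCU : ∀ k x y t, |U (x, t) k - U (y, t) k| ≤ |C₁ k + C₂ k| * ‖x - y‖ ^ β := fun k x y t => by
    rw [hUe', hUe', add_sub_add_comm]
    refine (abs_add_le _ _).trans ((add_le_add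
      (heat0_holder (hinit k).1 (hinit k).2.1 (hC₁ k) x y _) (hC₂ k x y _ (htp (x, t)))).trans ?_)
    rw [← add_mul]
    gcongr
    exact le_abs_self _
  refine ⟨lo, hi, U, g, M, L * ∑ k, |C₁ k + C₂ k|, hlohi, hbox, hUc, hmem, hUp, fun e q => ?_, hgc,
    hgM, by positivity, fun x y t => ?_, hUe'⟩
  · have : mfgValues T e U q ∈ Icc lo hi := ⟨fun k => (hmem _).1 k, fun k => (hmem _).2 k⟩
    simp only [hg, boxClamp_of_mem this]
  · have e1 : g none (y, t) = mfgSource H f (x, boxClamp lo hi (mfgValues T none U (y, t))) none := rfl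
    rw [e1]
    refine (hFL none x _ _).trans ?_
    rw [mul_assoc]
    gcongr
    refine (pi_norm_le_iff_of_nonneg (by positivity)).2 fun k => ?_
    refine (hCU k x y _).trans ?_
    gcongr
    exact Finset.single_le_sum (f := fun k => |C₁ k + C₂ k|) (fun i _ => abs_nonneg _)
      (Finset.mem_univ k)

lemma duhD_eq_duhW {N : ℕ} {G : RN N × ℝ → ℝ} {G' : Fin N → RN N × ℝ → ℝ} {M : ℝ}
    (hG : Continuous G) (hM : ∀ q, |G q| ≤ M) (hG' : ∀ i, Continuous (G' i))
    (hM' : ∀ i q, |G' i q| ≤ M)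
    (hd : ∀ s x, HasFDerivAt (fun y => G (y, s)) (formOf fun i => G' i (x, s)) x) (i : Fin N)
    (q : RN N × ℝ) : duhD i G q = duhW (G' i) q := by
  unfold duhD duhW duh
  congr 1; funext θ
  by_cases h0 : √(2 * q.2) * θ = 0
  · rcases mul_eq_zero.1 h0 with h | h
    · simp [h]
    · subst h
      rw [mul_zero]
      simp only [avg, zero_smul, add_zero, integral_mul_const, mul_zero, zero_mul]
      have : ∫ z : RN N, gaussD1 i z = 0 := by
        have := avg_deriv_eq (N := N) (g := fun _ => 1) (g' := fun _ _ => 0) (M := 1) integrable_gaussD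
          integrable_gaussD1 hasFDerivAt_gaussD continuous_const (by simp) (fun _ => continuous_const)
          (by simp) (fun x => (hasFDerivAt_const _ _).congr_fderiv
            (clm_ext_single fun i => by simp)) one_ne_zero 0 i
        simpa [avg] using this
      rw [this]; ring
  · rw [avg_deriv_eq integrable_gaussD integrable_gaussD1 hasFDerivAt_gaussD (M := M)
      (g' := fun i y => G' i (y, q.2 * (1 - θ ^ 2))) (by fun_prop) (fun _ => hM _)
      (fun i => (hG' i).comp (by fun_prop)) (fun i _ => hM' i _) (hd _) h0]
    ring

/-- The source term of the Hamilton-Jacobi equation, in reversed time. -/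
def hjSource {N : ℕ} (H : RN N → ℝ) (f : RN N → ℝ → ℝ) (T : ℝ) (U : RN N × ℝ → MFGIndex N → ℝ)
    (q : RN N × ℝ) : ℝ :=
  -H (fun i => U q (some i, none)) - f q.1 (U (q.1, T - q.2) (none, none))

namespace MFGMild

variable {N : ℕ} {H : RN N → ℝ} {f : RN N → ℝ → ℝ} {m₀ uT : RN N → ℝ} {T β : ℝ}
  {lo hi : MFGIndex N → ℝ} {U : RN N × ℝ → MFGIndex N → ℝ}
  {g : Option (Fin N) → RN N × ℝ → ℝ} {M C A B : ℝ}

lemma pos (h : MFGMild H f m₀ uT T β lo hi U g M C) (q : RN N × ℝ) : 0 < U q (none, none) :=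
  h.box (h.mem q)

lemma hasFDerivAt (h : MFGMild H f m₀ uT T β lo hi U g M C)
    (hA : C2Data m₀ (fun i => pd i m₀) (fun i j => pd j (pd i m₀)) A)
    (hB : C2Data uT (fun i => pd i uT) (fun i j => pd j (pd i uT)) B) (e : Option (Fin N)) (t : ℝ)
    (x : RN N) :
    HasFDerivAt (fun y => U (y, t) (e, none)) (formOf fun j => U (x, t) (e, some j)) x := by
  have h0 : ∀ x, HasFDerivAt (fun y => heat0 (mfgInit m₀ uT (e, none)) (timeProj T (y, t)))
      (formOf fun j => heat0 (mfgInit m₀ uT (e, some j)) (timeProj T (x, t))) x := fun x => by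
    match e with
    | none => exact hasFDerivAt_heat0 hA.cont hA.bound hA.cont₁ hA.bound₁ hA.deriv₁ x (max 0 (min t T))
    | some i =>
      exact hasFDerivAt_heat0 (hB.cont₁ i) (hB.bound₁ i) (hB.cont₂ i) (hB.bound₂ i) (hB.deriv₂ i) x
        (max 0 (min t T))
  have h1 : HasFDerivAt (fun y => duhW (g e) (timeProj T (y, t)))
      (formOf fun j => duhD j (g e) (timeProj T (x, t))) x :=
    hasFDerivAt_duhW (h.cont_g e) (h.bound_g e) x (max 0 (min t T))
  have e1 : (fun y => U (y, t) (e, none)) = fun y =>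
      heat0 (mfgInit m₀ uT (e, none)) (timeProj T (y, t)) + duhW (g e) (timeProj T (y, t)) :=
    funext fun y => h.eq _ _
  rw [e1]
  refine ((h0 x).add h1).congr_fderiv (clm_ext_single fun j => ?_)
  simp only [_root_.add_apply, formOf_single]
  exact (h.eq (e, some j) (x, t)).symm

lemma continuous_hjSource (h : MFGMild H f m₀ uT T β lo hi U g M C) (hH : ContDiff ℝ 3 H)
    (hf : ContDiffOn ℝ 3 (fun q : RN N × ℝ => f q.1 q.2)
      ((Set.univ : Set (RN N)) ×ˢ Ioi (0:ℝ))) : Continuous (hjSource H f T U) := by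
  have hU := h.cont
  refine (hH.continuous.comp (by fun_prop)).neg.sub ?_
  exact hf.continuousOn.comp_continuous
    (f := fun q : RN N × ℝ => (q.1, U (q.1, T - q.2) (none, none))) (by fun_prop)
    fun q => ⟨mem_univ _, h.pos _⟩

lemma exists_bound_hjSource (h : MFGMild H f m₀ uT T β lo hi U g M C) (hH : ContDiff ℝ 3 H)
    (hf : ContDiffOn ℝ 3 (fun q : RN N × ℝ => f q.1 q.2)
      ((Set.univ : Set (RN N)) ×ˢ Ioi (0:ℝ)))
    (hfper : ∀ s, ZPeriodic fun x => f x s) : ∃ M', ∀ q, |hjSource H f T U q| ≤ M' := by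
  let F : RN N × (MFGIndex N → ℝ) → Unit → ℝ := fun p _ =>
    -H (fun i => p.2 (some i, none)) - f p.1 (p.2 (none, none))
  have hv : ∀ k, ContDiff ℝ 1 fun p : RN N × (MFGIndex N → ℝ) => p.2 k := fun k =>
    (contDiff_apply ℝ ℝ k).comp contDiff_snd
  have hF : ContDiffOn ℝ 1 F (univ ×ˢ mfgDomain N) := by
    refine contDiffOn_pi.2 fun _ => ContDiffOn.sub ?_ ?_
    · exact ((hH.of_le (by norm_num)).comp (contDiff_pi.2 fun i => hv (some i, none))).neg.contDiffOn
    · exact (hf.of_le (by norm_num)).comp (contDiff_fst.prodMk (hv (none, none))).contDiffOn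
        fun p hp => ⟨mem_univ _, hp.2⟩
  obtain ⟨-, M', -, -, -, hM', -⟩ := exists_bound_lipschitz_boxClamp hF
    (fun v => zPeriodic_iff.2 fun a ha x => funext fun _ => by
      simp only [F]; rw [zPeriodic_iff.1 (hfper _) a ha x]) h.lo_le_hi h.box
  refine ⟨M', fun q => ?_⟩
  let V : MFGIndex N → ℝ := fun k => U (q.1, if k.1.isSome then q.2 else T - q.2) k
  have hV : V ∈ Icc lo hi := ⟨fun k => (h.mem _).1 k, fun k => (h.mem _).2 k⟩
  have := hM' () (q.1, V)
  rw [boxClamp_of_mem hV] at this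
  exact this

lemma hasFDerivAt_hjSource (h : MFGMild H f m₀ uT T β lo hi U g M C)
    (hA : C2Data m₀ (fun i => pd i m₀) (fun i j => pd j (pd i m₀)) A)
    (hB : C2Data uT (fun i => pd i uT) (fun i j => pd j (pd i uT)) B) (hH : ContDiff ℝ 3 H)
    (hf : ContDiffOn ℝ 3 (fun q : RN N × ℝ => f q.1 q.2)
      ((Set.univ : Set (RN N)) ×ˢ Ioi (0:ℝ))) (s : ℝ) (x : RN N) :
    HasFDerivAt (fun y => hjSource H f T U (y, s)) (formOf fun i => g (some i) (x, s)) x := by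
  have hp : HasFDerivAt (fun y (i : Fin N) => U (y, s) (some i, none))
      (ContinuousLinearMap.pi fun i => formOf fun j => U (x, s) (some i, some j)) x :=
    hasFDerivAt_pi.2 fun i => h.hasFDerivAt hA hB (some i) s x
  have hm := h.hasFDerivAt hA hB none (T - s) x
  have hH' := ((hH.differentiable (by norm_num)) (fun i => U (x, s) (some i, none))).hasFDerivAt
  have hmem : (x, U (x, T - s) (none, none)) ∈ (univ : Set (RN N)) ×ˢ Ioi (0:ℝ) :=
    ⟨mem_univ _, h.pos (x, T - s)⟩
  have hf' : HasFDerivAt (fun q : RN N × ℝ => f q.1 q.2)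
      (fderiv ℝ (fun q : RN N × ℝ => f q.1 q.2) (x, U (x, T - s) (none, none)))
      (x, U (x, T - s) (none, none)) :=
    ((hf.contDiffAt ((isOpen_univ.prod isOpen_Ioi).mem_nhds hmem)).differentiableAt
      (by norm_num)).hasFDerivAt
  refine (((hH'.comp x hp).neg).sub (hf'.comp x ((hasFDerivAt_id x).prodMk hm))).congr_fderiv
    (clm_ext_single fun i => ?_)
  rw [formOf_single, h.source]
  have e1 : ContinuousLinearMap.pi (fun i => formOf fun j => U (x, s) (some i, some j))
      (Pi.single i 1) = fun k => U (x, s) (some k, some i) := by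
    funext k; exact formOf_single _ _
  simp only [_root_.sub_apply, _root_.neg_apply, ContinuousLinearMap.comp_apply,
    ContinuousLinearMap.prod_apply, ContinuousLinearMap.id_apply, formOf_single, e1, mfgSource,
    mfgValues]
  congr 2
  rw [clm_eq_formOf (fderiv ℝ H _), formOf_apply]
  rfl

end MFGMild

lemma SpaceTimeC2.congr_deriv {N : ℕ} {T : ℝ} {w : RN N → ℝ → ℝ} {W' : RN N × ℝ → ℝ}
    {W₁ V₁ : Fin N → RN N × ℝ → ℝ} {W₂ : Fin N → Fin N → RN N × ℝ → ℝ}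
    (h : SpaceTimeC2 T w W' W₁ W₂) (hV : ∀ i x, ∀ t ∈ Icc 0 T, V₁ i (x, t) = W₁ i (x, t)) :
    SpaceTimeC2 T w W' V₁ W₂ where
  per := h.per
  cont := h.cont
  contT := h.contT
  cont₁ := fun i => (h.cont₁ i).congr fun q hq => hV i q.1 q.2 hq.2
  cont₂ := h.cont₂
  derivT := h.derivT
  deriv₁ := fun t ht x => by simpa only [hV _ _ t ht] using h.deriv₁ t ht x
  deriv₂ := fun i t ht x => by simpa only [hV _ _ t ht] using h.deriv₂ i t ht x

lemma timeProj_of_mem {N : ℕ} {T t : ℝ} (ht : t ∈ Icc 0 T) (x : RN N) :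
    timeProj T (x, t) = (x, t) := by
  simp [timeProj, min_eq_left ht.2, max_eq_right ht.1]

namespace MFGMild

variable {N : ℕ} {H : RN N → ℝ} {f : RN N → ℝ → ℝ} {m₀ uT : RN N → ℝ} {T β : ℝ}
  {lo hi : MFGIndex N → ℝ} {U : RN N × ℝ → MFGIndex N → ℝ}
  {g : Option (Fin N) → RN N × ℝ → ℝ} {M C A B : ℝ}

lemma zPeriodic_source (h : MFGMild H f m₀ uT T β lo hi U g M C)
    (hfper : ∀ s, ZPeriodic fun x => f x s) (e : Option (Fin N)) (t : ℝ) :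
    ZPeriodic fun x => g e (x, t) := by
  refine zPeriodic_iff.2 fun a ha x => ?_
  have h1 : mfgValues T e U (x + a, t) = mfgValues T e U (x, t) := by
    funext k
    exact congrFun (h.per a ha (x, if e.isSome == k.1.isSome then t else T - t)) k
  simp only [h.source, h1]
  exact congrFun (zPeriodic_iff.1 (zPeriodic_mfgSource hfper (mfgValues T e U (x, t))) a ha x) e

lemma zPeriodic_hjSource (h : MFGMild H f m₀ uT T β lo hi U g M C)
    (hfper : ∀ s, ZPeriodic fun x => f x s) (t : ℝ) :
    ZPeriodic fun x => hjSource H f T U (x, t) := by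
  refine zPeriodic_iff.2 fun a ha x => ?_
  have h1 := h.per a ha (x, t)
  have h2 := h.per a ha (x, T - t)
  simp only at h1 h2
  simp only [hjSource, h1, h2]
  rw [zPeriodic_iff.1 (hfper _) a ha x]

lemma exists_density (h : MFGMild H f m₀ uT T β lo hi U g M C) (hβ : β ∈ Ioo (0:ℝ) 1)
    (hA : C2Data m₀ (fun i => pd i m₀) (fun i j => pd j (pd i m₀)) A)
    (hfper : ∀ s, ZPeriodic fun x => f x s) (hm₀per : ZPeriodic m₀) :
    ∃ (m : RN N → ℝ → ℝ) (M₂ : Fin N → Fin N → RN N × ℝ → ℝ),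
      (∀ x, ∀ t ∈ Icc 0 T, m x t = U (x, t) (none, none)) ∧ (∀ x, m x 0 = m₀ x) ∧
      SpaceTimeC2 T m (fun q => ∑ i, M₂ i i q + g none q) (fun i q => U q (none, some i)) M₂ := by
  obtain ⟨m, M₂, h1, h2, h3⟩ := exists_heat_solution hA hβ (h.cont_g none) (h.bound_g none)
    h.holder_g h.C_nonneg hm₀per (fun i => zPeriodic_pd (zPeriodic_pd hm₀per i) i)
    (h.zPeriodic_source hfper none) T
  refine ⟨m, M₂, fun x t ht => ?_, h2, h3.congr_deriv fun i x t ht => ?_⟩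
  · rw [h1 x t ht, h.eq, timeProj_of_mem ht]; rfl
  · rw [h.eq, timeProj_of_mem ht]; rfl

lemma exists_value (h : MFGMild H f m₀ uT T β lo hi U g M C) (hβ : β ∈ Ioo (0:ℝ) 1)
    (hA : C2Data m₀ (fun i => pd i m₀) (fun i j => pd j (pd i m₀)) A)
    (hB : C2Data uT (fun i => pd i uT) (fun i j => pd j (pd i uT)) B) (hH : ContDiff ℝ 3 H)
    (hf : ContDiffOn ℝ 3 (fun q : RN N × ℝ => f q.1 q.2)
      ((Set.univ : Set (RN N)) ×ˢ Ioi (0:ℝ)))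
    (hfper : ∀ s, ZPeriodic fun x => f x s) (huTper : ZPeriodic uT) :
    ∃ (u : RN N → ℝ → ℝ) (V₂ : Fin N → Fin N → RN N × ℝ → ℝ), (∀ x, u x 0 = uT x) ∧
      (∀ i j x, ∀ t ∈ Icc 0 T, V₂ i j (x, t) = U (x, t) (some i, some j)) ∧
      SpaceTimeC2 T u (fun q => ∑ i, V₂ i i q + hjSource H f T U q)
        (fun i q => U q (some i, none)) V₂ := by
  have cG := h.continuous_hjSource hH hf
  obtain ⟨M', hM'⟩ := h.exists_bound_hjSource hH hf hfper
  have hd := h.hasFDerivAt_hjSource hA hB hH hf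
  have hM0 : 0 ≤ M := (abs_nonneg _).trans (h.bound_g none 0)
  have hM'0 : 0 ≤ M' := (abs_nonneg _).trans (hM' 0)
  obtain ⟨u, V₂, -, h2, h3⟩ := exists_heat_solution hB hβ cG hM'
    (fun x y t => exists_holder_of_form hβ (fun x => hM' (x, t)) hM0 (hd t)
      (fun i x => h.bound_g (some i) (x, t)) x y) (by positivity) huTper
    (fun i => zPeriodic_pd (zPeriodic_pd huTper i) i) (h.zPeriodic_hjSource hfper) T
  have h4 := h3.congr_deriv (V₁ := fun i q => U q (some i, none)) fun i x t ht => by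
    rw [h.eq, timeProj_of_mem ht, duhD_eq_duhW (M := max M' M) cG
      (fun q => (hM' q).trans (le_max_left _ _)) (fun i => h.cont_g (some i))
      (fun i q => (h.bound_g (some i) q).trans (le_max_right _ _)) hd]
    rfl
  refine ⟨u, V₂, h2, fun i j x t ht => ?_, h4⟩
  rw [← pd_eq_of_hasFDerivAt (h4.deriv₂ i t ht x) j,
    ← pd_eq_of_hasFDerivAt (h.hasFDerivAt hA hB (some i) t x) j]

end MFGMild

/-- A density and a value function of class `C²` in space and `C¹` in time, given with their
derivatives, solve the mean field game system as soon as these derivatives satisfy the expanded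
equations. -/
lemma classicalSol_of_spaceTimeC2 {N : ℕ} {T : ℝ} {H : RN N → ℝ} {fc : RN N → ℝ → ℝ → ℝ}
    {m₀ uT : RN N → ℝ} (hH : ContDiff ℝ 3 H) {u m : RN N → ℝ → ℝ} {u' m' : RN N × ℝ → ℝ}
    {u₁ m₁ : Fin N → RN N × ℝ → ℝ} {u₂ m₂ : Fin N → Fin N → RN N × ℝ → ℝ}
    (hu : SpaceTimeC2 T u u' u₁ u₂) (hm : SpaceTimeC2 T m m' m₁ m₂)
    (hjb : ∀ x, ∀ t ∈ Icc 0 T,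
      -u' (x, t) - ∑ i, u₂ i i (x, t) + H (fun i => u₁ i (x, t)) = fc x t (m x t))
    (fkp : ∀ x, ∀ t ∈ Icc 0 T, m' (x, t) - ∑ i, m₂ i i (x, t) -
      ∑ k, (m₁ k (x, t) * pd k H (fun i => u₁ i (x, t)) +
        m x t * ∑ l, pd l (pd k H) (fun i => u₁ i (x, t)) * u₂ l k (x, t)) = 0)
    (init : ∀ x, m x 0 = m₀ x) (final : ∀ x, u x T = uT x) :
    ClassicalSol N T H fc m₀ uT u m where
  per_u := hu.per
  per_m := hm.per
  cont_u := hu.cont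
  cont_m := hm.cont
  cont_ut := hu.contT.congr fun q hq => (hu.derivT q.1 q.2 hq.2).deriv
  cont_mt := hm.contT.congr fun q hq => (hm.derivT q.1 q.2 hq.2).deriv
  cont_du := fun i => (hu.cont₁ i).congr fun q hq => congrFun (hu.pd_eq i hq.2) q.1
  cont_dm := fun i => (hm.cont₁ i).congr fun q hq => congrFun (hm.pd_eq i hq.2) q.1
  cont_ddu := fun i j => (hu.cont₂ j i).congr fun q hq => hu.pd_pd_eq i j hq.2 q.1
  cont_ddm := fun i j => (hm.cont₂ j i).congr fun q hq => hm.pd_pd_eq i j hq.2 q.1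
  tdiff_u := fun x t ht => (hu.derivT x t (Ioo_subset_Icc_self ht)).differentiableAt
  tdiff_m := fun x t ht => (hm.derivT x t (Ioo_subset_Icc_self ht)).differentiableAt
  xdiff_u := fun t ht => ⟨fun x => (hu.deriv₁ t ht x).differentiableAt, fun i => by
    rw [hu.pd_eq i ht]; exact fun x => (hu.deriv₂ i t ht x).differentiableAt⟩
  xdiff_m := fun t ht => ⟨fun x => (hm.deriv₁ t ht x).differentiableAt, fun i => by
    rw [hm.pd_eq i ht]; exact fun x => (hm.deriv₂ i t ht x).differentiableAt⟩
  hjb := fun x t ht => by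
    have ht' := Ioo_subset_Icc_self ht
    rw [← hjb x t ht', (hu.derivT x t ht').deriv]
    have : grad (fun y => u y t) x = fun i => u₁ i (x, t) :=
      funext fun i => congrFun (hu.pd_eq i ht') x
    simp only [lap, hu.pd_pd_eq _ _ ht', this]
  fkp := fun x t ht => by
    have ht' := Ioo_subset_Icc_self ht
    rw [← fkp x t ht', (hm.derivT x t ht').deriv]
    have hg : ∀ y, grad (fun z => u z t) y = fun i => u₁ i (y, t) := fun y =>
      funext fun i => congrFun (hu.pd_eq i ht') y
    simp only [lap, hm.pd_pd_eq _ _ ht', dive]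
    congr 1
    refine Finset.sum_congr rfl fun k _ => ?_
    have hp : HasFDerivAt (fun y (i : Fin N) => u₁ i (y, t))
        (ContinuousLinearMap.pi fun i => formOf fun j => u₂ i j (x, t)) x :=
      hasFDerivAt_pi.2 fun i => hu.deriv₂ i t ht' x
    have hHk := hasFDerivAt_formOf_pd (((contDiff_pd (m := 2) hH (by norm_num) k).differentiable
      (by norm_num)) (fun i => u₁ i (x, t)))
    have e1 : ContinuousLinearMap.pi (fun i => formOf fun j => u₂ i j (x, t))
        (Pi.single k 1) = fun l => u₂ l k (x, t) := funext fun l => formOf_single _ _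
    have e2 : (fun y => (m y t • grad H (grad (fun z => u z t) y)) k)
        = (fun y => m y t) * (pd k H ∘ fun y (i : Fin N) => u₁ i (y, t)) := by
      funext y; simp only [hg]; rfl
    rw [e2]
    change fderiv ℝ _ x (Pi.single k 1) = _
    rw [((hm.deriv₁ t ht' x).mul (hHk.comp x hp)).fderiv]
    simp only [_root_.add_apply, _root_.smul_apply, ContinuousLinearMap.comp_apply, smul_eq_mul, e1,
      formOf_single, Function.comp_apply]
    rw [formOf_apply, add_comm, mul_comm (pd k H _)]
  init := init
  final := final

lemma exists_norm_holder_of_euclNorm {N : ℕ} {β : ℝ} (hβ : 0 ≤ β) {v : RN N → ℝ} {C : ℝ}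
    (h : ∀ x y, |v x - v y| ≤ C * euclNorm (fun k => x k - y k) ^ β) :
    ∃ C, ∀ x y, |v x - v y| ≤ C * ‖x - y‖ ^ β := by
  refine ⟨|C| * √N ^ β, fun x y => (h x y).trans ?_⟩
  have h0 : 0 ≤ euclNorm fun k => x k - y k := Real.sqrt_nonneg _
  have h1 : (euclNorm fun k => x k - y k) ≤ √N * ‖x - y‖ := by
    rw [← Real.sqrt_sq (norm_nonneg (x - y)), ← Real.sqrt_mul (Nat.cast_nonneg N)]
    refine Real.sqrt_le_sqrt ?_
    calc ∑ k, (x k - y k) ^ 2 ≤ ∑ _k : Fin N, ‖x - y‖ ^ 2 :=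
          Finset.sum_le_sum fun k _ => by
            rw [← sq_abs]
            exact pow_le_pow_left₀ (abs_nonneg _) (norm_le_pi_norm (x - y) k) 2
      _ = N * ‖x - y‖ ^ 2 := by simp
  rw [mul_assoc, ← Real.mul_rpow (Real.sqrt_nonneg _) (norm_nonneg _)]
  exact mul_le_mul (le_abs_self C) (Real.rpow_le_rpow h0 h1 hβ) (Real.rpow_nonneg h0 β)
    (abs_nonneg C)

/-- **Theorem 1.4** (existence of classical solutions for short time horizons,
with no growth assumptions on `f` and `H`). -/
theorem mfg_exists_short_time (N : ℕ) (hN : 1 ≤ N) (β : ℝ) (hβ : β ∈ Ioo (0:ℝ) 1)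
    (H : RN N → ℝ) (f : RN N → ℝ → ℝ) (m₀ uT : RN N → ℝ)
    (hH : ContDiff ℝ 3 H)
    (hf : ContDiffOn ℝ 3 (fun q : RN N × ℝ => f q.1 q.2)
      ((Set.univ : Set (RN N)) ×ˢ Ioi (0:ℝ)))
    (hfper : ∀ s, ZPeriodic fun x => f x s)
    (hm₀reg : ContDiff ℝ 2 m₀) (hm₀per : ZPeriodic m₀)
    (hm₀hold : ∀ i j, ∃ C, ∀ x y,
      |pd i (pd j m₀) x - pd i (pd j m₀) y| ≤ C * euclNorm (fun k => x k - y k) ^ β)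
    (huTreg : ContDiff ℝ 2 uT) (huTper : ZPeriodic uT)
    (huThold : ∀ i j, ∃ C, ∀ x y,
      |pd i (pd j uT) x - pd i (pd j uT) y| ≤ C * euclNorm (fun k => x k - y k) ^ β)
    (hm₀pos : ∀ x, 0 < m₀ x) (hm₀int : (∫ x in cube N, m₀ x) = 1) :
    ∃ Tstar > (0:ℝ), ∀ T : ℝ, 0 < T → T ≤ Tstar →
      ∃ u m : RN N → ℝ → ℝ, ClassicalSol N T H (fun x _ mv => -f x mv) m₀ uT u m := by
  obtain ⟨A, hA⟩ := exists_c2Data hm₀reg hm₀per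
  obtain ⟨B, hB⟩ := exists_c2Data huTreg huTper
  obtain ⟨Tstar, hT, hmild⟩ := exists_mfgMild hβ hH hf hfper hm₀reg hm₀per huTreg huTper
    (fun i j => (huThold i j).elim fun C h => exists_norm_holder_of_euclNorm hβ.1.le h) hm₀pos
  refine ⟨Tstar, hT, fun T hT0 hTs => ?_⟩
  obtain ⟨lo, hi, U, g, M, C, h⟩ := hmild T hT0 hTs
  obtain ⟨m, M₂, hm, hm0, hmC⟩ := h.exists_density hβ hA hfper hm₀per
  obtain ⟨u, V₂, hu0, hV, huC⟩ := h.exists_value hβ hA hB hH hf hfper huTper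
  refine ⟨_, m, classicalSol_of_spaceTimeC2 hH huC.reverse hmC (fun x t ht => ?_)
    (fun x t ht => ?_) hm0 fun x => by simpa using hu0 x⟩
  · simp only [hjSource, hm x t ht, sub_sub_cancel]
    ring
  · have ht' : T - t ∈ Icc 0 T := ⟨by linarith [ht.2], by linarith [ht.1]⟩
    simp only [h.source, mfgSource, mfgValues, hm x t ht, hV _ _ x _ ht']
    simp
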